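/- The set of all C*-norms on the algebraic tensor product B(ℓ²) ⊗_ℂ B(ℓ²) has cardinality at least 2^ℵ₀ (the cardinality of the continuum), where ℓ² = ℓ²(ℕ, ℂ). -/

import Mathlib

set_option synthInstance.maxHeartbeats 1000000
set_option maxHeartbeats 1000000

open scoped TensorProduct

noncomputable section CStarNormDefs

namespace PaperCStarNorms

variable {A B : Type*} [Ring A] [Algebra ℂ A] [StarRing A] [StarModule ℂ A]
  [Ring B] [Algebra ℂ B] [StarRing B] [StarModule ℂ B]

/-- The canonical involution on the algebraic tensor product `A ⊗[ℂ] B` of two complex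
`*`-algebras, determined by `(a ⊗ b)* = a* ⊗ b*`. -/
def tensorStarAux : A ⊗[ℂ] B →+ A ⊗[ℂ] B :=
  TensorProduct.liftAddHom
    (AddMonoidHom.mk'
      (fun a => AddMonoidHom.mk' (fun b => star a ⊗ₜ[ℂ] star b)
        (fun b₁ b₂ => by simp [star_add, TensorProduct.tmul_add]))
      (fun a₁ a₂ => by
        ext b
        simp [star_add, TensorProduct.add_tmul]))
    (fun c a b => by
      simp [star_smul, TensorProduct.smul_tmul', TensorProduct.tmul_smul])

@[simp] lemma tensorStarAux_tmul (a : A) (b : B) :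
    tensorStarAux (a ⊗ₜ[ℂ] b) = star a ⊗ₜ[ℂ] star b :=
  TensorProduct.liftAddHom_tmul _ _ _ _

instance : StarRing (A ⊗[ℂ] B) where
  star := tensorStarAux
  star_involutive x := by
    show tensorStarAux (tensorStarAux x) = x
    induction x using TensorProduct.induction_on with
    | zero => simp
    | tmul a b => simp
    | add x y hx hy => simp only [map_add, hx, hy]
  star_mul x y := by
    show tensorStarAux (x * y) = tensorStarAux y * tensorStarAux x
    induction x using TensorProduct.induction_on with
    | zero => simp
    | tmul a b =>
      induction y using TensorProduct.induction_on with
      | zero => simp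
      | tmul c d => simp [Algebra.TensorProduct.tmul_mul_tmul]
      | add y₁ y₂ h₁ h₂ => rw [mul_add, map_add, h₁, h₂, map_add, add_mul]
    | add x₁ x₂ h₁ h₂ => rw [add_mul, map_add, h₁, h₂, map_add, mul_add]
  star_add x y := map_add tensorStarAux x y

@[simp] lemma star_tmul (a : A) (b : B) :
    star (a ⊗ₜ[ℂ] b) = star a ⊗ₜ[ℂ] star b := rfl

end PaperCStarNorms

/-- A C*-seminorm on a complex `*`-algebra `A`. -/
def IsCstarSeminorm {A : Type*} [Ring A] [Algebra ℂ A] [StarRing A] (f : A → ℝ) : Prop :=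
  (∀ x, 0 ≤ f x) ∧ (∀ x y, f (x + y) ≤ f x + f y) ∧
  (∀ (c : ℂ) (x), f (c • x) = ‖c‖ * f x) ∧ (∀ x y, f (x * y) ≤ f x * f y) ∧
  (∀ x, f (star x) = f x) ∧ (∀ x, f (star x * x) = f x ^ 2)

/-- A C*-norm on a complex `*`-algebra `A`. -/
def IsCstarNorm {A : Type*} [Ring A] [Algebra ℂ A] [StarRing A] (f : A → ℝ) : Prop :=
  IsCstarSeminorm f ∧ ∀ x, f x = 0 → x = 0

end CStarNormDefs

/-- The Hilbert space `ℓ² = ℓ²(ℕ, ℂ)` of square-summable complex sequences. -/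
noncomputable abbrev ellTwo : Type := lp (fun _ : ℕ => ℂ) 2

set_option synthInstance.maxHeartbeats 1000000
set_option maxHeartbeats 1000000
open scoped TensorProduct

section Spatial

variable {H : Type} [NormedAddCommGroup H] [InnerProductSpace ℂ H] [CompleteSpace H]

/-- The algebraic tensor square with its inner product. -/
def TSq (H : Type) [NormedAddCommGroup H] [InnerProductSpace ℂ H] : Type := H ⊗[ℂ] H
noncomputable instance tsqN : NormedAddCommGroup (TSq H) := (TensorProduct.instNormedAddCommGroup : NormedAddCommGroup (H ⊗[ℂ] H))
noncomputable instance tsqI : InnerProductSpace ℂ (TSq H) := (TensorProduct.instInnerProductSpace : InnerProductSpace ℂ (H ⊗[ℂ] H))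

noncomputable instance tsqInner : Inner ℂ (TSq H) := InnerProductSpace.toInner

set_option linter.unusedSectionVars false
local notation "BH" => (H →L[ℂ] H)
local notation "EE" => TSq H

/-- pure tensors -/
noncomputable def pt (x y : H) : TSq H := x ⊗ₜ[ℂ] y

lemma pt_induction {P : TSq H → Prop} (h0 : P 0) (ht : ∀ x y, P (pt x y))
    (ha : ∀ u v, P u → P v → P (u + v)) (u : TSq H) : P u := by
  exact TensorProduct.induction_on (motive := fun u : H ⊗[ℂ] H => P u) u h0 ht ha

lemma inner_pt (x y x' y' : H) : inner ℂ (pt x y) (pt x' y') = inner ℂ x x' * inner ℂ y y' :=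
  TensorProduct.inner_tmul ℂ x x' y y'

lemma pt_add_left (x x' y : H) : pt (x + x') y = pt x y + pt x' y := TensorProduct.add_tmul x x' y
lemma pt_add_right (x y y' : H) : pt x (y + y') = pt x y + pt x y' := TensorProduct.tmul_add x y y'
lemma pt_smul_left (c : ℂ) (x y : H) : pt (c • x) y = c • pt x y := rfl
lemma pt_smul_right (c : ℂ) (x y : H) : pt x (c • y) = c • pt x y := TensorProduct.tmul_smul c x y

noncomputable def mapE (a b : BH) : EE →L[ℂ] EE := (TensorProduct.mapL a b : H ⊗[ℂ] H →L[ℂ] H ⊗[ℂ] H)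
lemma mapE_pt (a b : BH) (x y : H) : mapE a b (pt x y) = pt (a x) (b y) := rfl
lemma norm_mapE (a b : BH) : ‖mapE a b‖ ≤ ‖a‖ * ‖b‖ := TensorProduct.norm_mapL_le a b

lemma clm_pt_ext {S T : EE →L[ℂ] EE} (h : ∀ x y, S (pt x y) = T (pt x y)) : S = T := by
  ext1 u
  induction u using pt_induction with
  | h0 => simp
  | ht x y => exact h x y
  | ha u v hu hv => rw [map_add, map_add, hu, hv]

noncomputable def rhoLin : BH ⊗[ℂ] BH →ₗ[ℂ] (EE →L[ℂ] EE) :=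
  TensorProduct.lift (LinearMap.mk₂ ℂ (fun a b => mapE a b)
    (fun a a' b => clm_pt_ext fun x y => by simp [mapE_pt, pt_add_left])
    (fun c a b => clm_pt_ext fun x y => by simp [mapE_pt, pt_smul_left])
    (fun a b b' => clm_pt_ext fun x y => by simp [mapE_pt, pt_add_right])
    (fun c a b => clm_pt_ext fun x y => by simp [mapE_pt, pt_smul_right]))

lemma rhoLin_tmul (a b : BH) : rhoLin (a ⊗ₜ b) = mapE a b := rfl

noncomputable def rho : BH ⊗[ℂ] BH →ₐ[ℂ] (EE →L[ℂ] EE) :=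
  Algebra.TensorProduct.algHomOfLinearMapTensorProduct rhoLin
    (fun a b a' b' => by
      simp only [rhoLin_tmul]; exact clm_pt_ext fun x y => by simp [mapE_pt])
    (by rw [rhoLin_tmul]; exact clm_pt_ext fun x y => by simp [mapE_pt])

lemma rho_tmul (a b : BH) : rho (a ⊗ₜ b) = mapE a b := rfl

lemma rho_tmul_tmul (a b : BH) (x y : H) : rho (a ⊗ₜ b) (pt x y) = pt (a x) (b y) := rfl

lemma inner_rho (x : BH ⊗[ℂ] BH) (u v : EE) :
    inner ℂ (rho x u) v = inner ℂ u (rho (star x) v) := by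
  induction x using TensorProduct.induction_on with
  | zero => simp
  | add x y hx hy =>
    simp only [map_add, star_add, add_apply, inner_add_left, inner_add_right, hx, hy]
  | tmul a b =>
    rw [PaperCStarNorms.star_tmul]
    induction u using pt_induction with
    | h0 => simp
    | ha u u' hu hu' => simp only [map_add, inner_add_left, hu, hu']
    | ht p q =>
      induction v using pt_induction with
      | h0 => simp
      | ha u u' hu hu' => simp only [map_add, inner_add_right, hu, hu']
      | ht r s =>
        rw [rho_tmul_tmul, rho_tmul_tmul, inner_pt, inner_pt]
        rw [ContinuousLinearMap.star_eq_adjoint, ContinuousLinearMap.star_eq_adjoint,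
          ContinuousLinearMap.adjoint_inner_right, ContinuousLinearMap.adjoint_inner_right]
/-- The spatial norm. -/
noncomputable def nu (x : BH ⊗[ℂ] BH) : ℝ := ‖rho x‖

lemma nu_nonneg (x : BH ⊗[ℂ] BH) : 0 ≤ nu x := norm_nonneg _
lemma nu_add (x y : BH ⊗[ℂ] BH) : nu (x + y) ≤ nu x + nu y := by unfold nu; rw [map_add]; exact norm_add_le _ _
lemma nu_smul (c : ℂ) (x : BH ⊗[ℂ] BH) : nu (c • x) = ‖c‖ * nu x := by unfold nu; rw [map_smul, norm_smul]
lemma nu_mul (x y : BH ⊗[ℂ] BH) : nu (x * y) ≤ nu x * nu y := by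
  unfold nu; rw [map_mul]; exact norm_mul_le _ _
lemma nu_zero : nu (0 : BH ⊗[ℂ] BH) = 0 := by simp [nu]
lemma nu_neg (x : BH ⊗[ℂ] BH) : nu (-x) = nu x := by simp [nu]
lemma nu_sub (x y : BH ⊗[ℂ] BH) : nu (x - y) ≤ nu x + nu y := by
  unfold nu; rw [map_sub]; exact norm_sub_le _ _
lemma nu_tmul (a b : BH) : nu (a ⊗ₜ b) ≤ ‖a‖ * ‖b‖ := by
  unfold nu; rw [rho_tmul]; exact norm_mapE _ _
lemma nu_sum {ι : Type*} (s : Finset ι) (f : ι → BH ⊗[ℂ] BH) :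
    nu (∑ i ∈ s, f i) ≤ ∑ i ∈ s, nu (f i) := by
  unfold nu; rw [map_sum]; exact norm_sum_le _ _

lemma nu_sq_le (x : BH ⊗[ℂ] BH) : nu x ^ 2 ≤ nu (star x * x) := by
  have h : nu x ≤ Real.sqrt (nu (star x * x)) := by
    refine ContinuousLinearMap.opNorm_le_bound _ (Real.sqrt_nonneg _) fun v => ?_
    rw [← Real.sqrt_sq (norm_nonneg v), ← Real.sqrt_mul (nu_nonneg _)]
    refine Real.le_sqrt_of_sq_le ?_
    have h1 : ‖rho x v‖ ^ 2 = ‖inner ℂ v (rho (star x * x) v)‖ := by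
      rw [map_mul, mul_apply_eq_comp, ← inner_rho, inner_self_eq_norm_sq_to_K]
      simp
    rw [h1]
    calc _ ≤ ‖v‖ * ‖rho (star x * x) v‖ := norm_inner_le_norm _ _
      _ ≤ ‖v‖ * (nu (star x * x) * ‖v‖) := by
          gcongr; exact ContinuousLinearMap.le_opNorm _ _
      _ = _ := by ring
  calc _ ≤ Real.sqrt (nu (star x * x)) ^ 2 := by gcongr; exact nu_nonneg _
    _ = _ := Real.sq_sqrt (nu_nonneg _)

lemma nu_le_star (x : BH ⊗[ℂ] BH) : nu x ≤ nu (star x) := by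
  have h := (nu_sq_le x).trans (nu_mul _ _)
  rcases (nu_nonneg x).eq_or_lt with h0 | h0
  · rw [← h0]; exact nu_nonneg _
  · exact le_of_mul_le_mul_right (by rw [← sq]; exact h) h0

lemma nu_star (x : BH ⊗[ℂ] BH) : nu (star x) = nu x :=
  le_antisymm (by simpa using nu_le_star (star x)) (nu_le_star x)

lemma nu_faithful (x : BH ⊗[ℂ] BH) (h : nu x = 0) : x = 0 := by
  have h0 : rho x = 0 := by simpa [nu] using h
  obtain ⟨c, rfl⟩ := TensorProduct.eq_repr_basis_right (Module.Basis.ofVectorSpace ℂ BH) x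
  set b := Module.Basis.ofVectorSpace ℂ BH
  suffices hc : ∀ i, c i = 0 by simp [Finsupp.sum, hc]
  intro i
  ext1 p
  refine ext_inner_left ℂ fun q => ?_
  have key : c.sum (fun j m => (inner ℂ q (m p)) • b j) = 0 := by
    ext1 r
    refine ext_inner_left ℂ fun s => ?_
    have := congrArg (fun T : EE →L[ℂ] EE => inner ℂ (pt q s) (T (pt p r))) h0
    simp only [Finsupp.sum, map_sum, sum_apply, rho_tmul_tmul, inner_sum,
      inner_pt] at this
    simp only [Finsupp.sum, sum_apply, inner_sum,
      smul_apply, inner_smul_right]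
    simpa using this
  by_cases hi : i ∈ c.support
  · have := linearIndependent_iff'.1 b.linearIndependent c.support (fun j => inner ℂ q (c j p)) key i hi
    simpa using this
  · have : c i = 0 := by simpa using hi
    simp [this]

end Spatial

set_option synthInstance.maxHeartbeats 1000000
set_option maxHeartbeats 1000000
open scoped TensorProduct

section Gap

/-- mass of a function on a set -/
noncomputable def mss {Y : Type} (F : Y → ℂ) (S : Set Y) : ENNReal :=
  ∑' y, S.indicator (fun y => ENNReal.ofReal (‖F y‖ ^ 2)) y

/-- defect of a permutation -/
noncomputable def dfc {Y : Type} (F : Y → ℂ) (A : Equiv.Perm Y) : ENNReal :=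
  ∑' y, ENNReal.ofReal (‖F (A y) - F y‖ ^ 2)

lemma dfc_symm {Y : Type} (F : Y → ℂ) (A : Equiv.Perm Y) : dfc F A.symm = dfc F A := by
  unfold dfc
  rw [← A.tsum_eq]
  simp [norm_sub_rev]

lemma pw_ineq (u v : ℂ) : 2 * ‖u‖ ^ 2 ≤ 3 * ‖v‖ ^ 2 + 6 * ‖v - u‖ ^ 2 := by
  have h : ‖u‖ ≤ ‖v‖ + ‖v - u‖ := by
    have := norm_sub_le v (v - u)
    simpa using this
  have h0 := norm_nonneg u
  have h1 := norm_nonneg v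
  have h2 := norm_nonneg (v - u)
  nlinarith [sq_nonneg (‖v‖ - 2 * ‖v - u‖)]

lemma mss_half {Y : Type} (F : Y → ℂ) (A B : Equiv.Perm Y) (S R D : Set Y)
    (hA : ∀ y ∈ S, A y ∈ R ∧ A y ∈ D) (hB : ∀ y ∈ S, B y ∈ R ∧ B y ∉ D) :
    4 * mss F S ≤ 3 * mss F R + 6 * (dfc F A + dfc F B) := by
  classical
  have one : ∀ C : Equiv.Perm Y, 2 * mss F S ≤
      3 * (∑' y, S.indicator (fun y => ENNReal.ofReal (‖F (C y)‖ ^ 2)) y) + 6 * dfc F C := by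
    intro C
    unfold mss dfc
    rw [← ENNReal.tsum_mul_left, ← ENNReal.tsum_mul_left, ← ENNReal.tsum_mul_left,
      ← ENNReal.tsum_add]
    refine ENNReal.tsum_le_tsum fun y => ?_
    by_cases hy : y ∈ S
    · simp only [Set.indicator_of_mem hy]
      have := ENNReal.ofReal_le_ofReal (pw_ineq (F y) (F (C y)))
      rw [ENNReal.ofReal_add (by positivity) (by positivity), ENNReal.ofReal_mul (by norm_num),
        ENNReal.ofReal_mul (by norm_num), ENNReal.ofReal_mul (by norm_num)] at this
      simpa using this
    · simp [Set.indicator_of_notMem hy]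
  have hsum : (∑' y, S.indicator (fun y => ENNReal.ofReal (‖F (A y)‖ ^ 2)) y) +
      (∑' y, S.indicator (fun y => ENNReal.ofReal (‖F (B y)‖ ^ 2)) y) ≤ mss F R := by
    rw [← A.symm.tsum_eq, ← B.symm.tsum_eq
      (fun y => S.indicator (fun y => ENNReal.ofReal (‖F (B y)‖ ^ 2)) y), ← ENNReal.tsum_add]
    refine ENNReal.tsum_le_tsum fun y => ?_
    by_cases h1 : A.symm y ∈ S <;> by_cases h2 : B.symm y ∈ S
    · have := (hA _ h1).2; have := (hB _ h2).2
      simp_all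
    · have := (hA _ h1).1
      simp_all [Set.indicator_of_mem]
    · have := (hB _ h2).1
      simp_all [Set.indicator_of_mem]
    · simp [h1, h2]
  calc 4 * mss F S = 2 * mss F S + 2 * mss F S := by ring
    _ ≤ _ := add_le_add (one A) (one B)
    _ = 3 * ((∑' y, S.indicator (fun y => ENNReal.ofReal (‖F (A y)‖ ^ 2)) y) +
      (∑' y, S.indicator (fun y => ENNReal.ofReal (‖F (B y)‖ ^ 2)) y)) +
        6 * (dfc F A + dfc F B) := by ring
    _ ≤ _ := by gcongr

/-- representative in `(-1/2, 1/2]` -/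
noncomputable def rp (t : UnitAddCircle) : ℝ := (AddCircle.equivIoc 1 (-1/2) t : ℝ)

lemma rp_mem (t : UnitAddCircle) : -1/2 < rp t ∧ rp t ≤ 1/2 := by
  have := (AddCircle.equivIoc (1:ℝ) (-1/2) t).2
  constructor
  · exact this.1
  · have := this.2; unfold rp; linarith

lemma coe_rp (t : UnitAddCircle) : ((rp t : ℝ) : UnitAddCircle) = t :=
  AddCircle.coe_equivIoc

lemma rp_coe (x : ℝ) (h1 : -1/2 < x) (h2 : x ≤ 1/2) : rp (x : UnitAddCircle) = x := by
  unfold rp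
  rw [AddCircle.equivIoc_coe_of_mem]
  constructor <;> linarith

lemma rp_add (s t : UnitAddCircle) (h1 : -1/2 < rp s + rp t) (h2 : rp s + rp t ≤ 1/2) :
    rp (s + t) = rp s + rp t := by
  conv_lhs => rw [← coe_rp s, ← coe_rp t, ← AddCircle.coe_add]
  exact rp_coe _ h1 h2

lemma rp_sub (s t : UnitAddCircle) (h1 : -1/2 < rp s - rp t) (h2 : rp s - rp t ≤ 1/2) :
    rp (s - t) = rp s - rp t := by
  conv_lhs => rw [← coe_rp s, ← coe_rp t, ← AddCircle.coe_sub]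
  exact rp_coe _ h1 h2

lemma rp_eq_zero (t : UnitAddCircle) (h : rp t = 0) : t = 0 := by
  rw [← coe_rp t, h]; simp

/-- the basic character -/
noncomputable def ee (t : UnitAddCircle) : ℂ := (AddCircle.toCircle t : ℂ)

lemma norm_ee (t : UnitAddCircle) : ‖ee t‖ = 1 := Circle.norm_coe _

lemma ee_out (t : UnitAddCircle) (h : 1/4 ≤ |rp t|) (z : ℂ) :
    2 * ‖z‖ ^ 2 ≤ ‖ee t * z - z‖ ^ 2 := by
  have hm := rp_mem t
  have h1 : ee t * z - z = (ee t - 1) * z := by ring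
  rw [h1, norm_mul, mul_pow]
  have h2 : (2:ℝ) ≤ ‖ee t - 1‖ ^ 2 := by
    unfold ee
    rw [← coe_rp t, AddCircle.toCircle_apply_mk]
    rw [Circle.coe_exp, ← Complex.normSq_eq_norm_sq, Complex.normSq_apply]
    have hre : (Complex.exp (↑(2 * Real.pi / 1 * rp t) * Complex.I)).re
        = Real.cos (2 * Real.pi / 1 * rp t) := Complex.exp_ofReal_mul_I_re _
    have him : (Complex.exp (↑(2 * Real.pi / 1 * rp t) * Complex.I)).im
        = Real.sin (2 * Real.pi / 1 * rp t) := Complex.exp_ofReal_mul_I_im _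
    simp only [Complex.sub_re, Complex.sub_im, Complex.one_re, Complex.one_im, hre, him]
    have hc : Real.cos (2 * Real.pi / 1 * rp t) ≤ 0 := by
      rw [← Real.cos_abs]
      have habs : |rp t| ≤ 1/2 := abs_le.2 ⟨by linarith, by linarith⟩
      have : |2 * Real.pi / 1 * rp t| = 2 * Real.pi * |rp t| := by
        rw [abs_mul, abs_of_pos (by positivity)]; ring
      rw [this]
      have hpi := Real.pi_pos
      apply Real.cos_nonpos_of_pi_div_two_le_of_le <;> nlinarith
    nlinarith [Real.sin_sq_add_cos_sq (2 * Real.pi / 1 * rp t)]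
  nlinarith [sq_nonneg ‖z‖]

/-- defect of a multiplier -/
noncomputable def dfm {Y : Type} (F : Y → ℂ) (χ : Y → ℂ) : ENNReal :=
  ∑' y, ENNReal.ofReal (‖χ y * F y - F y‖ ^ 2)

lemma gap {Y : Type} (F : Y → ℂ) (A B : Equiv.Perm Y) (s t : Y → UnitAddCircle)
    (hsA : ∀ y, s (A y) = s y + t y) (htA : ∀ y, t (A y) = t y)
    (hsB : ∀ y, s (B y) = s y) (htB : ∀ y, t (B y) = s y + t y)
    (h0 : ∀ y, s y = 0 → t y = 0 → F y = 0) (hfin : mss F Set.univ ≠ ⊤) :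
    mss F Set.univ ≤ 12 * (dfm F (fun y => ee (s y)) + dfm F (fun y => ee (t y)) +
      dfc F A + dfc F B) := by
  classical
  set box : Set Y := {y | |rp (s y)| < 1/4 ∧ |rp (t y)| < 1/4} with hbox
  set R1 : Set Y := {y | (0 < rp (s y) ∧ 0 ≤ rp (t y)) ∨ (rp (s y) < 0 ∧ rp (t y) ≤ 0)} with hR1
  set R2 : Set Y := {y | (rp (s y) ≤ 0 ∧ 0 < rp (t y)) ∨ (0 ≤ rp (s y) ∧ rp (t y) < 0)} with hR2
  have hsA' : ∀ y, s (A.symm y) = s y - t y := fun y => by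
    have h1 := hsA (A.symm y); have h2 := htA (A.symm y); simp at h1 h2; rw [h1, h2]; abel
  have htA' : ∀ y, t (A.symm y) = t y := fun y => by
    have h2 := htA (A.symm y); simp at h2; rw [h2]
  have hsB' : ∀ y, s (B.symm y) = s y := fun y => by
    have h2 := hsB (B.symm y); simp at h2; rw [h2]
  have htB' : ∀ y, t (B.symm y) = t y - s y := fun y => by
    have h1 := hsB (B.symm y); have h2 := htB (B.symm y); simp at h1 h2; rw [h1, h2]; abel
  have half1 := mss_half F A B (R1 ∩ box) R1 {y | |rp (t y)| < |rp (s y)|}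
    (by
      rintro y ⟨hy, hb1, hb2⟩
      rw [abs_lt] at hb1 hb2
      have e : rp (s y + t y) = rp (s y) + rp (t y) := rp_add _ _ (by linarith) (by linarith)
      simp only [hR1, Set.mem_setOf_eq, hsA, htA, e]
      rcases hy with ⟨h1, h2⟩ | ⟨h1, h2⟩
      · refine ⟨Or.inl ⟨by linarith, h2⟩, ?_⟩
        rw [abs_of_nonneg h2, abs_of_nonneg (by linarith)]; linarith
      · refine ⟨Or.inr ⟨by linarith, h2⟩, ?_⟩
        rw [abs_of_nonpos h2, abs_of_nonpos (by linarith)]; linarith)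
    (by
      rintro y ⟨hy, hb1, hb2⟩
      rw [abs_lt] at hb1 hb2
      have e : rp (s y + t y) = rp (s y) + rp (t y) := rp_add _ _ (by linarith) (by linarith)
      simp only [hR1, Set.mem_setOf_eq, hsB, htB, e, not_lt]
      rcases hy with ⟨h1, h2⟩ | ⟨h1, h2⟩
      · refine ⟨Or.inl ⟨h1, by linarith⟩, ?_⟩
        rw [abs_of_nonneg h1.le, abs_of_nonneg (by linarith)]; linarith
      · refine ⟨Or.inr ⟨h1, by linarith⟩, ?_⟩
        rw [abs_of_nonpos h1.le, abs_of_nonpos (by linarith)]; linarith)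
  have half2 := mss_half F A.symm B.symm (R2 ∩ box) R2 {y | |rp (t y)| ≤ |rp (s y)|}
    (by
      rintro y ⟨hy, hb1, hb2⟩
      rw [abs_lt] at hb1 hb2
      have e : rp (s y - t y) = rp (s y) - rp (t y) := rp_sub _ _ (by linarith) (by linarith)
      simp only [hR2, Set.mem_setOf_eq, hsA', htA', e]
      rcases hy with ⟨h1, h2⟩ | ⟨h1, h2⟩
      · refine ⟨Or.inl ⟨by linarith, h2⟩, ?_⟩
        rw [abs_of_nonneg h2.le, abs_of_nonpos (by linarith)]; linarith
      · refine ⟨Or.inr ⟨by linarith, h2⟩, ?_⟩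
        rw [abs_of_nonpos h2.le, abs_of_nonneg (by linarith)]; linarith)
    (by
      rintro y ⟨hy, hb1, hb2⟩
      rw [abs_lt] at hb1 hb2
      have e : rp (t y - s y) = rp (t y) - rp (s y) := rp_sub _ _ (by linarith) (by linarith)
      simp only [hR2, Set.mem_setOf_eq, hsB', htB', e, not_le]
      rcases hy with ⟨h1, h2⟩ | ⟨h1, h2⟩
      · refine ⟨Or.inl ⟨h1, by linarith⟩, ?_⟩
        rw [abs_of_nonpos h1, abs_of_nonneg (by linarith)]; linarith
      · refine ⟨Or.inr ⟨h1, by linarith⟩, ?_⟩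
        rw [abs_of_nonneg h1, abs_of_nonpos (by linarith)]; linarith)
  rw [dfc_symm, dfc_symm] at half2
  have mono : ∀ S T : Set Y, S ⊆ T → mss F S ≤ mss F T := fun S T h =>
    ENNReal.tsum_le_tsum fun y => Set.indicator_le_indicator_of_subset h (fun _ => zero_le) y
  have hun : ∀ S T : Set Y, mss F (S ∪ T) ≤ mss F S + mss F T := fun S T => by
    unfold mss; rw [← ENNReal.tsum_add]
    refine ENNReal.tsum_le_tsum fun y => ?_
    by_cases h1 : y ∈ S <;> by_cases h2 : y ∈ T <;> simp [h1, h2]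
  have hout : 2 * mss F boxᶜ ≤ dfm F (fun y => ee (s y)) + dfm F (fun y => ee (t y)) := by
    unfold mss dfm
    rw [← ENNReal.tsum_add, ← ENNReal.tsum_mul_left]
    refine ENNReal.tsum_le_tsum fun y => ?_
    by_cases hy : y ∈ boxᶜ
    · rw [Set.indicator_of_mem hy]
      have h2 : (2 : ENNReal) * ENNReal.ofReal (‖F y‖ ^ 2) = ENNReal.ofReal (2 * ‖F y‖ ^ 2) := by
        rw [ENNReal.ofReal_mul (by norm_num)]; simp
      rw [h2]
      simp only [hbox, Set.mem_compl_iff, Set.mem_setOf_eq, not_and_or, not_lt] at hy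
      rcases hy with hy | hy
      · exact (ENNReal.ofReal_le_ofReal (ee_out _ hy _)).trans le_self_add
      · exact (ENNReal.ofReal_le_ofReal (ee_out _ hy _)).trans le_add_self
    · rw [Set.indicator_of_notMem hy]; simp
  have hall : mss F Set.univ ≤ mss F (R1 ∪ R2) := by
    refine ENNReal.tsum_le_tsum fun y => ?_
    by_cases hy : y ∈ R1 ∪ R2
    · simp [Set.indicator_of_mem hy]
    · have : F y = 0 := by
        have hy' : rp (s y) = 0 ∧ rp (t y) = 0 := by
          simp only [hR1, hR2, Set.mem_union, Set.mem_setOf_eq, not_or, not_and, not_lt, not_le] at hy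
          obtain ⟨⟨a, b⟩, c, d⟩ := hy
          rcases lt_trichotomy (rp (s y)) 0 with h | h | h
          · have := b h; have := c h.le; linarith
          · have := c h.le; have := d h.ge; exact ⟨h, by linarith⟩
          · have := a h; have := d h.le; linarith
        exact h0 y (rp_eq_zero _ hy'.1) (rp_eq_zero _ hy'.2)
      simp [this]
  have hall2 := hall.trans (hun R1 R2)
  have i1 : mss F R1 ≤ mss F (R1 ∩ box) + mss F boxᶜ := (mono _ _ (by
    intro y hy; by_cases h : y ∈ box
    · exact Or.inl ⟨hy, h⟩
    · exact Or.inr h)).trans (hun (R1 ∩ box) boxᶜ)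
  have i2 : mss F R2 ≤ mss F (R2 ∩ box) + mss F boxᶜ := (mono _ _ (by
    intro y hy; by_cases h : y ∈ box
    · exact Or.inl ⟨hy, h⟩
    · exact Or.inr h)).trans (hun (R2 ∩ box) boxᶜ)
  have fin : ∀ S, mss F S ≠ ⊤ := fun S => ne_top_of_le_ne_top hfin (mono _ _ (Set.subset_univ _))
  have f1 := fin R1
  have f2 := fin R2
  have f3 := fin (R1 ∩ box)
  have f4 := fin (R2 ∩ box)
  have f5 := fin boxᶜ
  generalize mss F R1 = q1 at *
  generalize mss F R2 = q2 at *
  generalize mss F (R1 ∩ box) = p1 at *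
  generalize mss F (R2 ∩ box) = p2 at *
  generalize mss F boxᶜ = o at *
  generalize mss F Set.univ = n at *
  generalize dfm F (fun y => ee (s y)) = a1 at *
  generalize dfm F (fun y => ee (t y)) = a2 at *
  generalize dfc F A = a3 at *
  generalize dfc F B = a4 at *
  rcases eq_or_ne (a1 + a2 + a3 + a4) ⊤ with htop | htop
  · rw [htop]; simp
  have g1 : a1 ≠ ⊤ := by rintro rfl; simp at htop
  have g2 : a2 ≠ ⊤ := by rintro rfl; simp at htop
  have g3 : a3 ≠ ⊤ := by rintro rfl; simp at htop
  have g4 : a4 ≠ ⊤ := by rintro rfl; simp at htop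
  lift q1 to NNReal using f1
  lift q2 to NNReal using f2
  lift p1 to NNReal using f3
  lift p2 to NNReal using f4
  lift o to NNReal using f5
  lift n to NNReal using hfin
  lift a1 to NNReal using g1
  lift a2 to NNReal using g2
  lift a3 to NNReal using g3
  lift a4 to NNReal using g4
  have pa := a1.2; have pb := a2.2; have pc := a3.2; have pd := a4.2
  norm_cast at *
  rw [← NNReal.coe_le_coe] at *
  push_cast at *
  linarith

end Gap

set_option synthInstance.maxHeartbeats 1000000
set_option maxHeartbeats 1000000
open scoped TensorProduct

section Ops

lemma memlp_wop (σ : Equiv.Perm ℕ) (χ : ℕ → ℂ) (hχ : ∀ a, ‖χ a‖ ≤ 1) (x : ellTwo) :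
    Memℓp (fun a => χ (σ.symm a) * x (σ.symm a)) 2 := by
  have hx : Summable fun a => ‖x a‖ ^ (2:ENNReal).toReal := (lp.memℓp x).summable (by simp)
  refine memℓp_gen ?_
  have h2 : Summable fun a => ‖x (σ.symm a)‖ ^ (2:ENNReal).toReal :=
    (Equiv.summable_iff σ.symm).2 hx
  refine Summable.of_nonneg_of_le (fun a => by positivity) (fun a => ?_) h2
  gcongr
  rw [norm_mul]
  exact mul_le_of_le_one_left (norm_nonneg _) (hχ _)

lemma ell_norm_sq (x : ellTwo) : ‖x‖ ^ 2 = ∑' a, ‖x a‖ ^ 2 := by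
  have := lp.norm_rpow_eq_tsum (p := 2) (by simp) x
  simpa using this

lemma ell_summable (x : ellTwo) : Summable fun a => ‖x a‖ ^ 2 := by
  have := (lp.memℓp x).summable (p := 2) (by simp)
  simpa using this

/-- weighted permutation operator -/
noncomputable def wop (σ : Equiv.Perm ℕ) (χ : {χ : ℕ → ℂ // ∀ a, ‖χ a‖ ≤ 1}) :
    ellTwo →L[ℂ] ellTwo :=
  LinearMap.mkContinuous
    { toFun := fun x => ⟨fun a => χ.1 (σ.symm a) * x (σ.symm a), memlp_wop σ χ.1 χ.2 x⟩
      map_add' := fun x y => by ext a; exact mul_add _ _ _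
      map_smul' := fun c x => by ext a; simp; ring } 1 (fun x => by
        rw [one_mul]
        refine (sq_le_sq₀ (norm_nonneg _) (norm_nonneg _)).1 ?_
        rw [ell_norm_sq, ell_norm_sq, ← σ.symm.tsum_eq (fun a => ‖x a‖ ^ 2)]
        refine Summable.tsum_le_tsum (fun a => ?_) (ell_summable _)
          ((Equiv.summable_iff σ.symm).2 (ell_summable x))
        simp only [LinearMap.coe_mk, AddHom.coe_mk, norm_mul]
        gcongr
        exact mul_le_of_le_one_left (norm_nonneg _) (χ.2 _))

lemma wop_apply (σ : Equiv.Perm ℕ) (χ : {χ : ℕ → ℂ // ∀ a, ‖χ a‖ ≤ 1}) (x : ellTwo) (a : ℕ) :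
    wop σ χ x a = χ.1 (σ.symm a) * x (σ.symm a) := rfl

lemma norm_wop (σ : Equiv.Perm ℕ) (χ : {χ : ℕ → ℂ // ∀ a, ‖χ a‖ ≤ 1}) : ‖wop σ χ‖ ≤ 1 :=
  LinearMap.mkContinuous_norm_le _ zero_le_one _

/-- coordinates of tensors -/
noncomputable def crd : TSq ellTwo →ₗ[ℂ] (ℕ × ℕ → ℂ) :=
  (TensorProduct.lift (LinearMap.mk₂ ℂ (fun (x y : ellTwo) => fun ab : ℕ × ℕ => x ab.1 * y ab.2)
    (fun x x' y => by ext; simp [add_mul])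
    (fun c x y => by ext; simp; ring)
    (fun x y y' => by ext; simp [mul_add])
    (fun c x y => by ext; simp; ring)) : ellTwo ⊗[ℂ] ellTwo →ₗ[ℂ] (ℕ × ℕ → ℂ))

lemma crd_pt (x y : ellTwo) (ab : ℕ × ℕ) : crd (pt x y) ab = x ab.1 * y ab.2 := rfl

lemma hasSum_mul_aux (f g : ℕ → ℂ) (x y : ℂ) (h1 : HasSum f x) (h2 : HasSum g y) :
    HasSum (fun ab : ℕ × ℕ => f ab.1 * g ab.2) (x * y) :=
  h1.mul h2 (summable_mul_of_summable_norm h1.summable.norm h2.summable.norm)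

lemma crd_hasSum (u v : TSq ellTwo) :
    HasSum (fun ab => inner ℂ (crd u ab) (crd v ab)) (inner ℂ u v) := by
  induction u using pt_induction with
  | h0 => simp
  | ha u u' hu hu' => simpa [inner_add_left, mul_add] using hu.add hu'
  | ht p q =>
    induction v using pt_induction with
    | h0 => simp
    | ha u u' hu hu' => simpa [inner_add_right, add_mul] using hu.add hu'
    | ht r s =>
      rw [inner_pt]
      have h1 := lp.hasSum_inner (𝕜 := ℂ) p r
      have h2 := lp.hasSum_inner (𝕜 := ℂ) q s
      have h3 := hasSum_mul_aux _ _ _ _ h1 h2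
      have e : (fun ab : ℕ × ℕ => inner ℂ (crd (pt p q) ab) (crd (pt r s) ab)) =
          fun ab : ℕ × ℕ => inner ℂ (p ab.1) (r ab.1) * inner ℂ (q ab.2) (s ab.2) := by
        ext ab
        simp [crd_pt]
        ring
      rw [e]
      exact h3

lemma crd_norm (u : TSq ellTwo) : HasSum (fun ab => ‖crd u ab‖ ^ 2) (‖u‖ ^ 2) := by
  have h := crd_hasSum u u
  have h2 := Complex.hasSum_re h
  have e : (inner ℂ u u).re = ‖u‖ ^ 2 := by
    rw [inner_self_eq_norm_sq_to_K]; norm_cast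
  rw [e] at h2
  have e2 : (fun ab => ‖crd u ab‖ ^ 2) = fun ab => (inner ℂ (crd u ab) (crd u ab)).re := by
    ext ab
    rw [inner_self_eq_norm_sq_to_K]; norm_cast
  rw [e2]
  exact h2

lemma crd_norm' (u : TSq ellTwo) :
    ∑' ab, ENNReal.ofReal (‖crd u ab‖ ^ 2) = ENNReal.ofReal (‖u‖ ^ 2) := by
  have h := crd_norm u
  rw [← h.tsum_eq, ENNReal.ofReal_tsum_of_nonneg (fun _ => by positivity) h.summable]

lemma crd_wop (σ : Equiv.Perm ℕ) (χ ψ : {χ : ℕ → ℂ // ∀ a, ‖χ a‖ ≤ 1}) (u : TSq ellTwo)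
    (ab : ℕ × ℕ) : crd (rho (wop σ χ ⊗ₜ wop σ ψ) u) ab =
      χ.1 (σ.symm ab.1) * ψ.1 (σ.symm ab.2) * crd u (σ.symm ab.1, σ.symm ab.2) := by
  induction u using pt_induction with
  | h0 => simp
  | ha u u' hu hu' => simp [hu, hu', mul_add]
  | ht p q => rw [rho_tmul_tmul, crd_pt, crd_pt, wop_apply, wop_apply]; ring

lemma crd_inj (u v : TSq ellTwo) (h : ∀ ab, crd u ab = crd v ab) : u = v := by
  have h1 : crd (u - v) = 0 := by ext ab; simp [h]
  have h2 := crd_norm (u - v)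
  rw [h1] at h2
  have h3 : ‖u - v‖ ^ 2 = 0 := by
    refine h2.unique ?_
    simp
  have : ‖u - v‖ = 0 := by simpa using h3
  exact sub_eq_zero.1 (norm_eq_zero.1 this)

/-- combinatorial data -/
structure Dat where
  cls : ℕ → Nat.Primes
  A : Equiv.Perm ℕ
  B : Equiv.Perm ℕ
  s : ℕ → UnitAddCircle
  t : ℕ → UnitAddCircle
  clsA : ∀ a, cls (A a) = cls a
  clsB : ∀ a, cls (B a) = cls a
  sA : ∀ a, s (A a) = s a + t a
  tA : ∀ a, t (A a) = t a
  sB : ∀ a, s (B a) = s a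
  tB : ∀ a, t (B a) = s a + t a
  sep : ∀ a b, s a = s b → t a = t b → cls a = cls b
  fin : ∀ p, {a | cls a = p}.Finite
  ne : ∀ p, ∃ a, cls a = p

namespace Dat
variable (d : Dat)

/-- the permutations -/
def P (g : Fin 5) : Equiv.Perm ℕ := ![1, 1, 1, d.A, d.B] g
/-- the characters -/
noncomputable def M (g : Fin 5) (a : ℕ) : ℂ := ![1, ee (d.s a), ee (d.t a), 1, 1] g

lemma norm_M (g : Fin 5) (a : ℕ) : ‖d.M g a‖ = 1 := by
  fin_cases g <;> simp [M, norm_ee]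

lemma clsP (g : Fin 5) (a : ℕ) : d.cls (d.P g a) = d.cls a := by
  fin_cases g <;> simp [P, clsA, clsB]

lemma clsP' (g : Fin 5) (a : ℕ) : d.cls ((d.P g).symm a) = d.cls a := by
  have := d.clsP g ((d.P g).symm a); simpa using this.symm

open Classical in
/-- weights -/
noncomputable def wU (S : Set Nat.Primes) (g : Fin 5) : {χ : ℕ → ℂ // ∀ a, ‖χ a‖ ≤ 1} :=
  ⟨fun a => if d.cls a ∈ S then d.M g a else 0, fun a => by dsimp only; split_ifs <;> simp [norm_M]⟩
open Classical in
/-- weights -/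
noncomputable def wV (S : Set Nat.Primes) (g : Fin 5) : {χ : ℕ → ℂ // ∀ a, ‖χ a‖ ≤ 1} :=
  ⟨fun a => if d.cls a ∈ S then 0 else star (d.M g a), fun a => by dsimp only; split_ifs <;> simp [norm_M]⟩
/-- first legs -/
noncomputable def U (S : Set Nat.Primes) (g : Fin 5) : ellTwo →L[ℂ] ellTwo := wop (d.P g) (d.wU S g)
/-- second legs -/
noncomputable def V (S : Set Nat.Primes) (g : Fin 5) : ellTwo →L[ℂ] ellTwo := wop (d.P g) (d.wV S g)

lemma norm_U (S : Set Nat.Primes) (g : Fin 5) : ‖d.U S g‖ ≤ 1 := norm_wop _ _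
lemma norm_V (S : Set Nat.Primes) (g : Fin 5) : ‖d.V S g‖ ≤ 1 := norm_wop _ _

lemma lower (S S' : Set Nat.Primes) (p : Nat.Primes) (h : p ∈ S) (h' : p ∉ S') :
    5 ≤ nu (∑ g, d.U S g ⊗ₜ[ℂ] d.V S' g) := by
  classical
  set ζ : TSq ellTwo := ∑ a ∈ (d.fin p).toFinset, pt (lp.single 2 a (1:ℂ)) (lp.single 2 a (1:ℂ)) with hζ
  have hc : ∀ ab : ℕ × ℕ, crd ζ ab = if ab.1 = ab.2 ∧ d.cls ab.1 = p then 1 else 0 := by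
    rintro ⟨a, b⟩
    rw [hζ, map_sum, Finset.sum_apply]
    simp only [crd_pt, lp.single_apply, Pi.single_apply]
    by_cases hab : a = b
    · subst hab
      simp
    · rw [if_neg (by simp [hab])]
      refine Finset.sum_eq_zero fun c _ => ?_
      by_cases h1 : a = c
      · subst h1; simp [Ne.symm hab]
      · simp [h1]
  have hz : ζ ≠ 0 := by
    intro h0
    obtain ⟨a, ha⟩ := d.ne p
    have := hc (a, a)
    rw [h0] at this
    simp [ha] at this
  have hact : ∀ g, rho (d.U S g ⊗ₜ[ℂ] d.V S' g) ζ = ζ := by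
    intro g
    refine crd_inj _ _ fun ab => ?_
    unfold U V
    rw [crd_wop, hc, hc]
    simp only [clsP', (d.P g).symm.injective.eq_iff]
    by_cases hab : ab.1 = ab.2 ∧ d.cls ab.1 = p
    · rw [if_pos hab]
      have h2 : d.cls ab.2 = p := hab.1 ▸ hab.2
      simp only [wU, wV, clsP', hab.2, h2, h, h', hab.1, if_true, if_false]
      have := d.norm_M g ((d.P g).symm ab.2)
      rw [mul_one]
      have e := Complex.mul_conj (d.M g ((d.P g).symm ab.2))
      rw [Complex.normSq_eq_norm_sq, this] at e
      simpa using e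
    · rw [if_neg hab, mul_zero]
  have hsum : rho (∑ g, d.U S g ⊗ₜ[ℂ] d.V S' g) ζ = (5:ℂ) • ζ := by
    rw [map_sum rho, sum_apply]
    simp [hact, ← Nat.cast_smul_eq_nsmul ℂ]
  have hle := ContinuousLinearMap.le_opNorm (rho (∑ g, d.U S g ⊗ₜ[ℂ] d.V S' g)) ζ
  rw [hsum, norm_smul] at hle
  have hpos : 0 < ‖ζ‖ := norm_pos_iff.2 hz
  have := le_of_mul_le_mul_right hle hpos
  unfold nu
  refine le_trans ?_ this
  simp

end Dat
end Ops

set_option synthInstance.maxHeartbeats 1000000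
set_option maxHeartbeats 1000000
open scoped TensorProduct

section Ops2

lemma hilb_gap {K : Type} [NormedAddCommGroup K] [InnerProductSpace ℂ K] (f : Fin 5 → K)
    (hn : ∀ g, ‖f g‖ ≤ ‖f 0‖)
    (hg : ‖f 0‖ ^ 2 ≤ 12 * (‖f 1 - f 0‖ ^ 2 + ‖f 2 - f 0‖ ^ 2 + ‖f 3 - f 0‖ ^ 2 + ‖f 4 - f 0‖ ^ 2)) :
    ‖∑ g, f g‖ ≤ (5 - 1/200) * ‖f 0‖ := by
  have key : ∀ i, ‖f 0‖ ^ 2 / 48 ≤ ‖f i - f 0‖ ^ 2 → ‖f i + f 0‖ ≤ (2 - 1/200) * ‖f 0‖ := by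
    intro i hi
    have hp := parallelogram_law_with_norm ℂ (f i) (f 0)
    have h1 := hn i
    have h2 := norm_nonneg (f i)
    have h0 := norm_nonneg (f 0)
    refine (sq_le_sq₀ (norm_nonneg _) (by positivity)).1 ?_
    nlinarith
  rw [Fin.sum_univ_five]
  have a1 := hn 1; have a2 := hn 2; have a3 := hn 3; have a4 := hn 4
  by_cases h1 : ‖f 0‖ ^ 2 / 48 ≤ ‖f 1 - f 0‖ ^ 2
  · have := key 1 h1
    calc _ = ‖(f 1 + f 0) + f 2 + f 3 + f 4‖ := by congr 1; abel
      _ ≤ ‖f 1 + f 0‖ + ‖f 2‖ + ‖f 3‖ + ‖f 4‖ := norm_add₄_le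
      _ ≤ _ := by linarith
  by_cases h2 : ‖f 0‖ ^ 2 / 48 ≤ ‖f 2 - f 0‖ ^ 2
  · have := key 2 h2
    calc _ = ‖(f 2 + f 0) + f 1 + f 3 + f 4‖ := by congr 1; abel
      _ ≤ ‖f 2 + f 0‖ + ‖f 1‖ + ‖f 3‖ + ‖f 4‖ := norm_add₄_le
      _ ≤ _ := by linarith
  by_cases h3 : ‖f 0‖ ^ 2 / 48 ≤ ‖f 3 - f 0‖ ^ 2
  · have := key 3 h3
    calc _ = ‖(f 3 + f 0) + f 1 + f 2 + f 4‖ := by congr 1; abel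
      _ ≤ ‖f 3 + f 0‖ + ‖f 1‖ + ‖f 2‖ + ‖f 4‖ := norm_add₄_le
      _ ≤ _ := by linarith
  have h4 : ‖f 0‖ ^ 2 / 48 ≤ ‖f 4 - f 0‖ ^ 2 := by linarith
  have := key 4 h4
  calc _ = ‖(f 4 + f 0) + f 1 + f 2 + f 3‖ := by congr 1; abel
      _ ≤ ‖f 4 + f 0‖ + ‖f 1‖ + ‖f 2‖ + ‖f 3‖ := norm_add₄_le
      _ ≤ _ := by linarith

lemma ee_sub (x y : UnitAddCircle) : ee (x - y) = ee x * star (ee y) := by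
  unfold ee
  rw [sub_eq_add_neg, AddCircle.toCircle_add, AddCircle.toCircle_neg, Circle.coe_mul,
    Circle.coe_inv_eq_conj]
  rfl

namespace Dat
variable (d : Dat)

lemma upper (S : Set Nat.Primes) : nu (∑ g, d.U S g ⊗ₜ[ℂ] d.V S g) ≤ 5 - 1/200 := by
  classical
  refine ContinuousLinearMap.opNorm_le_bound _ (by norm_num) fun ζ => ?_
  set f : Fin 5 → TSq ellTwo := fun g => rho (d.U S g ⊗ₜ[ℂ] d.V S g) ζ with hf
  have hsum : rho (∑ g, d.U S g ⊗ₜ[ℂ] d.V S g) ζ = ∑ g, f g := by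
    rw [map_sum rho, sum_apply]
  rw [hsum]
  have c0 : ∀ ab : ℕ × ℕ, crd (f 0) ab =
      if d.cls ab.1 ∈ S ∧ d.cls ab.2 ∉ S then crd ζ ab else 0 := by
    intro ab
    simp only [hf, U, V]
    rw [crd_wop]
    simp only [wU, wV, clsP']
    by_cases h1 : d.cls ab.1 ∈ S <;> by_cases h2 : d.cls ab.2 ∈ S <;> simp [h1, h2, P, M, Equiv.Perm.one_symm]
  have cg : ∀ g (ab : ℕ × ℕ), crd (f g) ab = d.M g ((d.P g).symm ab.1) *
      star (d.M g ((d.P g).symm ab.2)) * crd (f 0) ((d.P g).symm ab.1, (d.P g).symm ab.2) := by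
    intro g ab
    rw [c0]
    simp only [hf, U, V]
    rw [crd_wop]
    simp only [wU, wV, clsP']
    by_cases h1 : d.cls ab.1 ∈ S <;> by_cases h2 : d.cls ab.2 ∈ S <;> simp [h1, h2]
  have fg : ∀ g, f g = rho (d.U S g ⊗ₜ[ℂ] d.V S g) (f 0) := by
    intro g
    refine crd_inj _ _ fun ab => ?_
    rw [cg]
    simp only [U, V]
    rw [crd_wop, c0]
    simp only [wU, wV, clsP']
    by_cases h1 : d.cls ab.1 ∈ S <;> by_cases h2 : d.cls ab.2 ∈ S <;> simp [h1, h2]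
  have ball : ∀ g v, ‖rho (d.U S g ⊗ₜ[ℂ] d.V S g) v‖ ≤ ‖v‖ := by
    intro g v
    refine (ContinuousLinearMap.le_opNorm _ _).trans ?_
    refine mul_le_of_le_one_left (norm_nonneg _) ?_
    exact (nu_tmul _ _).trans (mul_le_one₀ (d.norm_U S g) (norm_nonneg _) (d.norm_V S g))
  have hn : ∀ g, ‖f g‖ ≤ ‖f 0‖ := fun g => by rw [fg g]; exact ball g _
  refine (hilb_gap f hn ?_).trans ?_
  swap
  · gcongr
    exact ball 0 ζ
  have hm : mss (crd (f 0)) Set.univ = ENNReal.ofReal (‖f 0‖ ^ 2) := by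
    rw [← crd_norm']; simp [mss]
  have hgap := gap (crd (f 0)) (Equiv.prodCongr d.A d.A) (Equiv.prodCongr d.B d.B)
    (fun ab => d.s ab.1 - d.s ab.2) (fun ab => d.t ab.1 - d.t ab.2)
    (fun y => by simp [d.sA]; abel) (fun y => by simp [d.tA])
    (fun y => by simp [d.sB]) (fun y => by simp [d.tB]; abel)
    (fun y h1 h2 => by
      rw [c0, if_neg]
      rintro ⟨h3, h4⟩
      have := d.sep y.1 y.2 (sub_eq_zero.1 h1) (sub_eq_zero.1 h2)
      exact h4 (this ▸ h3))
    (by rw [hm]; exact ENNReal.ofReal_ne_top)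
  rw [hm, ← dfc_symm, ← dfc_symm _ (Equiv.prodCongr d.B d.B)] at hgap
  have e1 : dfm (crd (f 0)) (fun y => ee (d.s y.1 - d.s y.2)) = ENNReal.ofReal (‖f 1 - f 0‖ ^ 2) := by
    rw [← crd_norm']
    unfold dfm
    refine tsum_congr fun ab => ?_
    rw [map_sub, Pi.sub_apply, cg 1]
    simp [P, M, ee_sub, Equiv.Perm.one_symm]
  have e2 : dfm (crd (f 0)) (fun y => ee (d.t y.1 - d.t y.2)) = ENNReal.ofReal (‖f 2 - f 0‖ ^ 2) := by
    rw [← crd_norm']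
    unfold dfm
    refine tsum_congr fun ab => ?_
    rw [map_sub, Pi.sub_apply, cg 2]
    simp [P, M, ee_sub, Equiv.Perm.one_symm]
  have e3 : dfc (crd (f 0)) (Equiv.prodCongr d.A d.A).symm = ENNReal.ofReal (‖f 3 - f 0‖ ^ 2) := by
    rw [← crd_norm']
    unfold dfc
    refine tsum_congr fun ab => ?_
    rw [map_sub, Pi.sub_apply, cg 3]
    simp [P, M, Prod.map]
  have e4 : dfc (crd (f 0)) (Equiv.prodCongr d.B d.B).symm = ENNReal.ofReal (‖f 4 - f 0‖ ^ 2) := by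
    rw [← crd_norm']
    unfold dfc
    refine tsum_congr fun ab => ?_
    rw [map_sub, Pi.sub_apply, cg 4]
    simp [P, M, Prod.map]
  rw [e1, e2, e3, e4, ← ENNReal.ofReal_add (by positivity) (by positivity),
    ← ENNReal.ofReal_add (by positivity) (by positivity),
    ← ENNReal.ofReal_add (by positivity) (by positivity)] at hgap
  have e12 : (12 : ENNReal) = ENNReal.ofReal 12 := by simp
  rw [e12, ← ENNReal.ofReal_mul (by norm_num), ENNReal.ofReal_le_ofReal_iff (by positivity)] at hgap
  exact hgap

end Dat

instance primesNeZero (p : Nat.Primes) : NeZero (p : ℕ) := ⟨p.2.ne_zero⟩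
instance primesFact (p : Nat.Primes) : Fact (1 < (p : ℕ)) := ⟨p.2.one_lt⟩

/-- fibre -/
abbrev Fib (p : Nat.Primes) : Type := {v : ZMod p × ZMod p // v ≠ 0}

/-- shear -/
def shA (p : Nat.Primes) : Equiv.Perm (Fib p) where
  toFun v := ⟨(v.1.1 + v.1.2, v.1.2), fun h => v.2 (by
    have h1 := congrArg Prod.fst h; have h2 := congrArg Prod.snd h
    simp at h1 h2; ext <;> simp_all)⟩
  invFun v := ⟨(v.1.1 - v.1.2, v.1.2), fun h => v.2 (by
    have h1 := congrArg Prod.fst h; have h2 := congrArg Prod.snd h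
    simp at h1 h2; ext <;> simp_all)⟩
  left_inv v := by simp
  right_inv v := by simp

/-- shear -/
def shB (p : Nat.Primes) : Equiv.Perm (Fib p) where
  toFun v := ⟨(v.1.1, v.1.1 + v.1.2), fun h => v.2 (by
    have h1 := congrArg Prod.fst h; have h2 := congrArg Prod.snd h
    simp at h1 h2; ext <;> simp_all)⟩
  invFun v := ⟨(v.1.1, v.1.2 - v.1.1), fun h => v.2 (by
    have h1 := congrArg Prod.fst h; have h2 := congrArg Prod.snd h
    simp at h1 h2; ext <;> simp_all)⟩
  left_inv v := by simp
  right_inv v := by simp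

lemma sep_aux (p q : Nat.Primes) (hpq : p ≠ q) (x : ZMod p) (y : ZMod q)
    (h : ZMod.toAddCircle x = ZMod.toAddCircle y) : x = 0 := by
  have h1 : (p : ℕ) • (ZMod.toAddCircle x) = 0 := by
    rw [← map_nsmul]; simp
  have h2 : (q : ℕ) • (ZMod.toAddCircle x) = 0 := by
    rw [h, ← map_nsmul]; simp
  have d1 := addOrderOf_dvd_of_nsmul_eq_zero h1
  have d2 := addOrderOf_dvd_of_nsmul_eq_zero h2
  have cop : Nat.Coprime p q := (Nat.coprime_primes p.2 q.2).2 (fun h => hpq (Subtype.ext h))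
  have d3 := Nat.eq_one_of_dvd_coprimes cop d1 d2
  rw [AddMonoid.addOrderOf_eq_one_iff] at d3
  exact ZMod.toAddCircle_injective _ (by rw [d3, map_zero])

theorem exists_dat : Nonempty Dat := by
  have hinf : Infinite ((p : Nat.Primes) × Fib p) := by
    refine Infinite.of_injective (fun p : Nat.Primes => (⟨p, ⟨(1, 0), by simp⟩⟩ : (p : Nat.Primes) × Fib p)) ?_
    intro p q h
    exact congrArg Sigma.fst h
  obtain ⟨e⟩ : Nonempty (((p : Nat.Primes) × Fib p) ≃ ℕ) := nonempty_equiv_of_countable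
  have hs : ∀ (sh : ∀ p, Equiv.Perm (Fib p)) (a : ℕ),
      e.symm (e.permCongr (Equiv.sigmaCongrRight sh) a) = ⟨(e.symm a).1, sh _ (e.symm a).2⟩ := by
    intro sh a
    simp only [Equiv.permCongr_apply, Equiv.symm_apply_apply]
    rfl
  refine ⟨{
    cls := fun n => (e.symm n).1
    A := e.permCongr (Equiv.sigmaCongrRight shA)
    B := e.permCongr (Equiv.sigmaCongrRight shB)
    s := fun n => ZMod.toAddCircle (e.symm n).2.1.1
    t := fun n => ZMod.toAddCircle (e.symm n).2.1.2
    clsA := fun a => by simp [Equiv.permCongr_apply]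
    clsB := fun a => by simp [Equiv.permCongr_apply]
    sA := fun a => (congrArg (fun x : (p : Nat.Primes) × Fib p => ZMod.toAddCircle x.2.1.1) (hs shA a)).trans (map_add _ _ _)
    tA := fun a => congrArg (fun x : (p : Nat.Primes) × Fib p => ZMod.toAddCircle x.2.1.2) (hs shA a) |>.trans rfl
    sB := fun a => congrArg (fun x : (p : Nat.Primes) × Fib p => ZMod.toAddCircle x.2.1.1) (hs shB a) |>.trans rfl
    tB := fun a => (congrArg (fun x : (p : Nat.Primes) × Fib p => ZMod.toAddCircle x.2.1.2) (hs shB a)).trans (map_add _ _ _)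
    sep := ?_
    fin := ?_
    ne := ?_ }⟩
  · intro a b h1 h2
    by_contra hne
    have k1 := sep_aux _ _ hne _ _ h1
    have k2 := sep_aux _ _ hne _ _ h2
    exact (e.symm a).2.2 (Prod.ext k1 k2)
  · intro p
    refine (Set.finite_range (fun v : Fib p => e ⟨p, v⟩)).subset ?_
    intro n hn
    rcases hx : e.symm n with ⟨q, v⟩
    have : q = p := by have : (e.symm n).1 = p := hn; rw [hx] at this; exact this
    subst this
    exact ⟨v, by rw [← e.apply_symm_apply n, hx]⟩
  · intro p
    exact ⟨e ⟨p, ⟨(1, 0), by simp⟩⟩, by simp⟩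

end Ops2

set_option synthInstance.maxHeartbeats 1000000
set_option maxHeartbeats 1000000
open scoped TensorProduct

section Cut

lemma real_cut (v : ℝ) (h0 : 0 ≤ v) (h1 : v ≤ 1) (k : ℕ) : (1 - v) * v ^ k ≤ 1 / (k + 1) := by
  have hs : (k + 1 : ℝ) * v ^ k ≤ ∑ j ∈ Finset.range (k + 1), v ^ j := by
    have : ∑ j ∈ Finset.range (k + 1), v ^ k ≤ ∑ j ∈ Finset.range (k + 1), v ^ j := by
      refine Finset.sum_le_sum fun j hj => ?_
      exact pow_le_pow_of_le_one h0 h1 (Nat.lt_succ_iff.1 (Finset.mem_range.1 hj))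
    simpa using this
  have hg := mul_neg_geom_sum v (k + 1)
  have hv : 0 ≤ v ^ (k + 1) := by positivity
  rw [le_div_iff₀ (by positivity)]
  nlinarith

variable {A : Type*} [CStarAlgebra A] [PartialOrder A] [StarOrderedRing A]

lemma cut_one (D : A) (h0 : 0 ≤ D) (M : ℝ) (hM : 0 < M) (hD : ‖D‖ ≤ M) (m : ℕ) :
    IsSelfAdjoint (1 - (M⁻¹ : ℂ) • D) ∧ ‖(1 - (M⁻¹ : ℂ) • D) ^ m‖ ≤ 1 ∧
    ‖(1 - (M⁻¹ : ℂ) • D) ^ m * D * (1 - (M⁻¹ : ℂ) • D) ^ m‖ ≤ M / (2 * m + 1) := by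
  have hsa : IsSelfAdjoint D := .of_nonneg h0
  have hp : (1 - (M⁻¹ : ℂ) • D) = cfc (fun t : ℝ => 1 - M⁻¹ * t) D := by
    rw [cfc_sub _ _ D, cfc_const_one ℝ D, cfc_const_mul _ _ D, cfc_id' ℝ D]
    congr 1
    rw [← Complex.ofReal_inv]
    exact Complex.coe_smul _ _
  have hpm : ∀ k : ℕ, (1 - (M⁻¹ : ℂ) • D) ^ k = cfc (fun t : ℝ => (1 - M⁻¹ * t) ^ k) D := by
    intro k
    rw [hp, cfc_pow _ k D]
  have hspec : ∀ t ∈ spectrum ℝ D, 0 ≤ t ∧ t ≤ M := by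
    intro t ht
    refine ⟨spectrum_nonneg_of_nonneg h0 ht, ?_⟩
    rcases subsingleton_or_nontrivial A with hA | hA
    · rw [spectrum.of_subsingleton] at ht; exact absurd ht (Set.notMem_empty _)
    exact (le_abs_self t).trans ((spectrum.norm_le_norm_of_mem ht).trans hD)
  have hb : ∀ t ∈ spectrum ℝ D, 0 ≤ 1 - M⁻¹ * t ∧ 1 - M⁻¹ * t ≤ 1 := by
    intro t ht
    obtain ⟨h1, h2⟩ := hspec t ht
    have : M⁻¹ * t ≤ 1 := by rw [inv_mul_le_iff₀ hM]; linarith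
    have : 0 ≤ M⁻¹ * t := by positivity
    constructor <;> linarith
  refine ⟨?_, ?_, ?_⟩
  · rw [hp]; exact cfc_predicate _ D
  · rw [hpm]
    refine norm_cfc_le zero_le_one fun t ht => ?_
    obtain ⟨h1, h2⟩ := hb t ht
    rw [Real.norm_eq_abs, abs_of_nonneg (by positivity)]
    exact pow_le_one₀ h1 h2
  · have e : (1 - (M⁻¹ : ℂ) • D) ^ m * D * (1 - (M⁻¹ : ℂ) • D) ^ m =
        cfc (fun t : ℝ => (1 - M⁻¹ * t) ^ m * t * (1 - M⁻¹ * t) ^ m) D := by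
      rw [cfc_mul _ _ D, cfc_mul _ _ D, cfc_id' ℝ D, hpm]
    rw [e]
    refine norm_cfc_le (by positivity) fun t ht => ?_
    obtain ⟨h1, h2⟩ := hb t ht
    obtain ⟨h3, h4⟩ := hspec t ht
    rw [Real.norm_eq_abs, abs_of_nonneg (by positivity)]
    have := real_cut _ h1 h2 (2 * m)
    have e2 : (1 - M⁻¹ * t) ^ m * t * (1 - M⁻¹ * t) ^ m =
        M * ((1 - (1 - M⁻¹ * t)) * (1 - M⁻¹ * t) ^ (2 * m)) := by
      field_simp; ring
    rw [e2, div_eq_mul_one_div]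
    gcongr
    simpa using this

lemma cut_sum {ι : Type*} (s : Finset ι) (d : ι → A) (M : ℝ) (hM : 0 < M)
    (hD : ‖∑ i ∈ s, star (d i) * d i‖ ≤ M) (m : ℕ) :
    ‖(1 - (M⁻¹ : ℂ) • ∑ i ∈ s, star (d i) * d i) ^ m‖ ≤ 1 ∧
    ∀ i ∈ s, ‖d i * (1 - (M⁻¹ : ℂ) • ∑ i ∈ s, star (d i) * d i) ^ m‖ ^ 2 ≤ M / (2 * m + 1) := by
  obtain ⟨h1, h2, h3⟩ := cut_one (∑ i ∈ s, star (d i) * d i)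
    (Finset.sum_nonneg fun i _ => star_mul_self_nonneg _) M hM hD m
  refine ⟨h2, fun i hi => le_trans ?_ h3⟩
  have hi' : star (d i) * d i ≤ ∑ i ∈ s, star (d i) * d i :=
    Finset.single_le_sum (f := fun i => star (d i) * d i) (fun i _ => star_mul_self_nonneg _) hi
  set D := ∑ i ∈ s, star (d i) * d i
  set p := (1 - (M⁻¹ : ℂ) • D) ^ m with hp
  have hps : star p = p := (h1.pow m).star_eq
  rw [sq, ← CStarRing.norm_star_mul_self, star_mul]
  have := star_left_conjugate_le_conjugate hi' p
  have h4 := CStarAlgebra.norm_le_norm_of_nonneg_of_le (a := star p * (star (d i) * d i) * p)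
    (by exact star_left_conjugate_nonneg (star_mul_self_nonneg _) p) this
  rw [hps] at h4 ⊢
  simpa [mul_assoc] using h4

end Cut

set_option synthInstance.maxHeartbeats 1000000
set_option maxHeartbeats 1000000
open scoped TensorProduct

section Quot

lemma cut_ring_identity {R : Type*} [Ring R] (γ s y w : R) :
    γ * s * (y * γ) = γ * ((s * y - w) * γ) + γ * (w * γ) := by
  noncomm_ring

/-- Bounded operators on `ℓ²`. -/
abbrev BE : Type := ellTwo →L[ℂ] ellTwo

variable {C : Type} [Ring C] [Algebra ℂ C] [StarRing C] [StarModule ℂ C] {L : Type}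

/-- The map `φ ⊗ 1`. -/
noncomputable def evT (φ : C →⋆ₐ[ℂ] BE) : C ⊗[ℂ] BE →ₐ[ℂ] BE ⊗[ℂ] BE :=
  Algebra.TensorProduct.map φ.toAlgHom (AlgHom.id ℂ BE)

lemma evT_tmul (φ : C →⋆ₐ[ℂ] BE) (c : C) (b : BE) : evT φ (c ⊗ₜ b) = φ c ⊗ₜ b := rfl

lemma evT_star (φ : C →⋆ₐ[ℂ] BE) (y : C ⊗[ℂ] BE) : evT φ (star y) = star (evT φ y) := by
  induction y using TensorProduct.induction_on with
  | zero => simp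
  | tmul a b =>
    rw [PaperCStarNorms.star_tmul, evT_tmul, evT_tmul, PaperCStarNorms.star_tmul, map_star]
  | add x y hx hy => rw [star_add, map_add, map_add, hx, hy, star_add]

variable (ev : L → C →⋆ₐ[ℂ] BE) (l0 : L)

/-- the set of admissible bounds of lifts. -/
def bdSet (x : BE ⊗[ℂ] BE) : Set ℝ :=
  {r | ∃ y : C ⊗[ℂ] BE, evT (ev l0) y = x ∧ ∀ l, nu (evT (ev l) y) ≤ r}

/-- the quotient norm. -/
noncomputable def qn (x : BE ⊗[ℂ] BE) : ℝ := sInf (bdSet ev l0 x)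

/-- The hypotheses on the family of evaluations. -/
structure GoodEv : Prop where
  bdd : ∀ c : C, ∃ M : ℝ, ∀ l, ‖ev l c‖ ≤ M
  surj : Function.Surjective (ev l0)

variable {ev l0} (hg : GoodEv ev l0)
include hg

lemma bd_tensor (y : C ⊗[ℂ] BE) : ∃ M : ℝ, ∀ l, nu (evT (ev l) y) ≤ M := by
  induction y using TensorProduct.induction_on with
  | zero => exact ⟨0, fun l => by rw [map_zero, nu_zero]⟩
  | tmul a b =>
    obtain ⟨M, hM⟩ := hg.bdd a
    refine ⟨M * ‖b‖, fun l => ?_⟩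
    rw [evT_tmul]
    exact (nu_tmul _ _).trans (by gcongr; exact hM l)
  | add x y hx hy =>
    obtain ⟨M, hM⟩ := hx
    obtain ⟨N, hN⟩ := hy
    refine ⟨M + N, fun l => ?_⟩
    rw [map_add]
    exact (nu_add _ _).trans (add_le_add (hM l) (hN l))

lemma surj_tensor (x : BE ⊗[ℂ] BE) : ∃ y, evT (ev l0) y = x := by
  induction x using TensorProduct.induction_on with
  | zero => exact ⟨0, map_zero _⟩
  | tmul a b =>
    obtain ⟨c, rfl⟩ := hg.surj a
    exact ⟨c ⊗ₜ b, rfl⟩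
  | add x y hx hy =>
    obtain ⟨u, rfl⟩ := hx
    obtain ⟨v, rfl⟩ := hy
    exact ⟨u + v, map_add _ _ _⟩

lemma bdSet_nonempty (x : BE ⊗[ℂ] BE) : (bdSet ev l0 x).Nonempty := by
  obtain ⟨y, hy⟩ := surj_tensor hg x
  obtain ⟨M, hM⟩ := bd_tensor hg y
  exact ⟨M, y, hy, hM⟩

omit hg in
lemma nu_le_of_mem {x : BE ⊗[ℂ] BE} {r : ℝ} (h : r ∈ bdSet ev l0 x) : nu x ≤ r := by
  obtain ⟨y, rfl, hy⟩ := h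
  exact hy l0

omit hg in
lemma bdSet_bddBelow (x : BE ⊗[ℂ] BE) : BddBelow (bdSet ev l0 x) :=
  ⟨nu x, fun _ h => nu_le_of_mem h⟩

omit hg in
lemma qn_le {x : BE ⊗[ℂ] BE} {r : ℝ} (h : r ∈ bdSet ev l0 x) : qn ev l0 x ≤ r :=
  csInf_le (bdSet_bddBelow x) h

lemma nu_le_qn (x : BE ⊗[ℂ] BE) : nu x ≤ qn ev l0 x :=
  le_csInf (bdSet_nonempty hg x) fun _ h => nu_le_of_mem h

lemma qn_nonneg (x : BE ⊗[ℂ] BE) : 0 ≤ qn ev l0 x := (nu_nonneg x).trans (nu_le_qn hg x)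

lemma mem_of_qn_lt {x : BE ⊗[ℂ] BE} {r : ℝ} (h : qn ev l0 x < r) : r ∈ bdSet ev l0 x := by
  obtain ⟨s, ⟨y, hy, hy'⟩, hs⟩ := exists_lt_of_csInf_lt (bdSet_nonempty hg x) h
  exact ⟨y, hy, fun l => (hy' l).trans hs.le⟩

lemma qn_add (x y : BE ⊗[ℂ] BE) : qn ev l0 (x + y) ≤ qn ev l0 x + qn ev l0 y := by
  refine le_of_forall_pos_le_add fun ε hε => ?_
  obtain ⟨u, hu, hu'⟩ := mem_of_qn_lt hg (x := x) (r := qn ev l0 x + ε / 2) (by linarith)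
  obtain ⟨v, hv, hv'⟩ := mem_of_qn_lt hg (x := y) (r := qn ev l0 y + ε / 2) (by linarith)
  refine qn_le ⟨u + v, by rw [map_add, hu, hv], fun l => ?_⟩
  rw [map_add]
  have := nu_add (evT (ev l) u) (evT (ev l) v)
  linarith [hu' l, hv' l]

lemma qn_mul (x y : BE ⊗[ℂ] BE) : qn ev l0 (x * y) ≤ qn ev l0 x * qn ev l0 y := by
  refine le_mul_of_forall_lt₀ fun a ha b hb => ?_
  obtain ⟨u, hu, hu'⟩ := mem_of_qn_lt hg ha
  obtain ⟨v, hv, hv'⟩ := mem_of_qn_lt hg hb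
  refine qn_le ⟨u * v, by rw [map_mul, hu, hv], fun l => ?_⟩
  rw [map_mul]
  refine (nu_mul _ _).trans ?_
  exact mul_le_mul (hu' l) (hv' l) (nu_nonneg _) ((nu_nonneg _).trans (hu' l))

lemma qn_star_le (x : BE ⊗[ℂ] BE) : qn ev l0 (star x) ≤ qn ev l0 x := by
  refine le_of_forall_gt_imp_ge_of_dense fun a ha => ?_
  obtain ⟨u, hu, hu'⟩ := mem_of_qn_lt hg ha
  refine qn_le ⟨star u, by rw [evT_star, hu], fun l => ?_⟩
  rw [evT_star, nu_star]; exact hu' l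

lemma qn_star (x : BE ⊗[ℂ] BE) : qn ev l0 (star x) = qn ev l0 x :=
  le_antisymm (qn_star_le hg x) (by simpa using qn_star_le hg (star x))

lemma qn_smul_le (c : ℂ) (x : BE ⊗[ℂ] BE) : qn ev l0 (c • x) ≤ ‖c‖ * qn ev l0 x := by
  refine le_mul_of_forall_lt₀ fun a ha b hb => ?_
  obtain ⟨u, hu, hu'⟩ := mem_of_qn_lt hg hb
  refine qn_le ⟨c • u, by rw [map_smul, hu], fun l => ?_⟩
  rw [map_smul, nu_smul]
  exact mul_le_mul ha.le (hu' l) (nu_nonneg _) ((norm_nonneg _).trans ha.le)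

lemma qn_smul (c : ℂ) (x : BE ⊗[ℂ] BE) : qn ev l0 (c • x) = ‖c‖ * qn ev l0 x := by
  refine le_antisymm (qn_smul_le hg c x) ?_
  by_cases hc : c = 0
  · subst hc; simpa using qn_nonneg hg _
  have h := qn_smul_le hg c⁻¹ (c • x)
  rw [smul_smul, inv_mul_cancel₀ hc, one_smul, norm_inv] at h
  have hc' : 0 < ‖c‖ := norm_pos_iff.2 hc
  calc ‖c‖ * qn ev l0 x ≤ ‖c‖ * (‖c‖⁻¹ * qn ev l0 (c • x)) := by gcongr
    _ = _ := by rw [← mul_assoc, mul_inv_cancel₀ hc'.ne', one_mul]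

lemma ker_cut (z : C ⊗[ℂ] BE) (hz : evT (ev l0) z = 0) (ε : ℝ) (hε : 0 < ε) :
    ∃ c : C, star c = c ∧ ev l0 c = 1 ∧ (∀ l, ‖ev l c‖ ≤ 1) ∧
      ∀ l, nu (evT (ev l) (z * (c ⊗ₜ[ℂ] (1 : BE)))) ≤ ε := by
  let 𝒞 := Module.Basis.ofVectorSpace ℂ BE
  obtain ⟨d, hd⟩ := TensorProduct.eq_repr_basis_right 𝒞 z
  have hd0 : ∀ i, ev l0 (d i) = 0 := by
    have h1 := TensorProduct.sum_tmul_basis_right_eq_zero 𝒞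
      (d.mapRange (ev l0) (map_zero _)) (by
        rw [Finsupp.sum_mapRange_index (by simp), ← hz, ← hd, Finsupp.sum, Finsupp.sum, map_sum]
        rfl)
    intro i
    have := DFunLike.congr_fun h1 i
    simpa using this
  set D : C := ∑ i ∈ d.support, star (d i) * d i with hD
  have hDl : ∀ l, ev l D = ∑ i ∈ d.support, star (ev l (d i)) * ev l (d i) := by
    intro l; rw [hD, map_sum]; simp [map_mul, map_star]
  obtain ⟨M0, hM0⟩ := hg.bdd D
  set M := max M0 1
  have hM : 0 < M := lt_of_lt_of_le one_pos (le_max_right _ _)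
  have hcut := fun (l : L) (m : ℕ) => cut_sum d.support (fun i => ev l (d i)) M hM
    (by rw [← hDl]; exact (hM0 l).trans (le_max_left _ _)) m
  set Bs := ∑ i ∈ d.support, ‖𝒞 i‖ with hBs
  have hBs0 : 0 ≤ Bs := Finset.sum_nonneg fun _ _ => norm_nonneg _
  obtain ⟨η, hη, hη'⟩ : ∃ η : ℝ, 0 < η ∧ η * Bs ≤ ε := by
    refine ⟨ε / (Bs + 1), by positivity, ?_⟩
    rw [div_mul_eq_mul_div, div_le_iff₀ (by positivity)]
    nlinarith
  obtain ⟨m, hm⟩ := exists_nat_gt (M / η ^ 2)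
  have hm2 : M / (2 * m + 1) ≤ η ^ 2 := by
    rw [div_lt_iff₀ (by positivity)] at hm
    rw [div_le_iff₀ (by positivity)]
    have : (0 : ℝ) ≤ m := by positivity
    nlinarith [sq_nonneg η]
  have hevc : ∀ l, ev l ((1 - (M⁻¹ : ℂ) • D) ^ m) =
      (1 - (M⁻¹ : ℂ) • ∑ i ∈ d.support, star (ev l (d i)) * ev l (d i)) ^ m := by
    intro l
    rw [map_pow, map_sub, map_one, map_smul, hDl]
  refine ⟨(1 - (M⁻¹ : ℂ) • D) ^ m, ?_, ?_, ?_, ?_⟩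
  · have : star D = D := by
      rw [hD, star_sum]; simp
    rw [star_pow, star_sub, star_one, star_smul, this]
    simp
  · rw [hevc]; simp [hd0]
  · intro l; rw [hevc]; exact (hcut l m).1
  · intro l
    have hsm : ∀ u : C ⊗[ℂ] BE, z * u = ∑ i ∈ d.support, (d i ⊗ₜ[ℂ] 𝒞 i) * u := by
      intro u; rw [← hd]; exact Finset.sum_mul d.support (fun i => d i ⊗ₜ[ℂ] 𝒞 i) u
    rw [hsm, map_sum]
    refine (nu_sum _ _).trans (le_trans (Finset.sum_le_sum (g := fun i => η * ‖𝒞 i‖) ?_) ?_)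
    · intro i hi
      rw [Algebra.TensorProduct.tmul_mul_tmul, mul_one, evT_tmul]
      refine (nu_tmul _ _).trans ?_
      gcongr
      rw [map_mul, hevc]
      exact abs_le_of_sq_le_sq' (((hcut l m).2 i hi).trans hm2) hη.le |>.2
    · rw [← Finset.mul_sum]; exact hη'

lemma qn_cstar (x : BE ⊗[ℂ] BE) : qn ev l0 (star x * x) = qn ev l0 x ^ 2 := by
  refine le_antisymm ((qn_mul hg _ _).trans (by rw [qn_star hg, sq])) ?_
  refine le_of_forall_pos_le_add fun ε hε => ?_
  obtain ⟨y, hy⟩ := surj_tensor hg x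
  obtain ⟨w, hw, hw'⟩ := mem_of_qn_lt hg (x := star x * x) (r := qn ev l0 (star x * x) + ε / 2)
    (by linarith)
  obtain ⟨c, hc, hc0, hc1, hc2⟩ := ker_cut hg (star y * y - w)
    (by rw [map_sub, map_mul, evT_star, hy, hw, sub_self]) (ε / 2) (by linarith)
  set R := qn ev l0 (star x * x) with hR
  have hR0 : 0 ≤ R := qn_nonneg hg _
  have key : ∀ l, nu (evT (ev l) (y * (c ⊗ₜ[ℂ] (1 : BE)))) ^ 2 ≤ R + ε := by
    intro l
    refine (nu_sq_le _).trans ?_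
    rw [← evT_star, ← map_mul, star_mul, PaperCStarNorms.star_tmul, hc, star_one]
    have hcn : nu (evT (ev l) (c ⊗ₜ[ℂ] (1 : BE))) ≤ 1 := by
      rw [evT_tmul]
      refine (nu_tmul _ _).trans ?_
      calc ‖ev l c‖ * ‖(1 : BE)‖ ≤ 1 * 1 := by
            gcongr
            · exact hc1 l
            · exact ContinuousLinearMap.norm_id_le
        _ = 1 := one_mul 1
    have e : c ⊗ₜ[ℂ] (1 : BE) * star y * (y * c ⊗ₜ[ℂ] (1 : BE)) =
        c ⊗ₜ[ℂ] (1 : BE) * ((star y * y - w) * c ⊗ₜ[ℂ] (1 : BE)) +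
        c ⊗ₜ[ℂ] (1 : BE) * (w * c ⊗ₜ[ℂ] (1 : BE)) := by
      exact cut_ring_identity (c ⊗ₜ[ℂ] (1 : BE)) (star y) y w
    rw [e, map_add, map_mul (evT (ev l)) (c ⊗ₜ[ℂ] (1 : BE)), map_mul (evT (ev l)) (c ⊗ₜ[ℂ] (1 : BE)),
      map_mul (evT (ev l)) w]
    set γ := evT (ev l) (c ⊗ₜ[ℂ] (1 : BE))
    have h1 := nu_add (γ * evT (ev l) ((star y * y - w) * c ⊗ₜ[ℂ] (1 : BE))) (γ * (evT (ev l) w * γ))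
    have h2 : nu (γ * evT (ev l) ((star y * y - w) * c ⊗ₜ[ℂ] (1 : BE))) ≤ 1 * (ε / 2) :=
      (nu_mul _ _).trans (mul_le_mul hcn (hc2 l) (nu_nonneg _) zero_le_one)
    have h3 : nu (γ * (evT (ev l) w * γ)) ≤ 1 * ((R + ε / 2) * 1) :=
      (nu_mul _ _).trans (mul_le_mul hcn ((nu_mul _ _).trans
        (mul_le_mul (hw' l) hcn (nu_nonneg _) (by linarith))) (nu_nonneg _) zero_le_one)
    linarith
  have hle : qn ev l0 x ≤ Real.sqrt (R + ε) := by
    refine qn_le ⟨y * (c ⊗ₜ[ℂ] (1 : BE)), ?_, fun l => Real.le_sqrt_of_sq_le (key l)⟩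
    rw [map_mul, hy, evT_tmul, hc0, ← Algebra.TensorProduct.one_def]
    exact mul_one x
  calc qn ev l0 x ^ 2 ≤ Real.sqrt (R + ε) ^ 2 := by
        gcongr; exact qn_nonneg hg _
    _ = R + ε := Real.sq_sqrt (by linarith)

theorem qn_isCstarNorm : IsCstarNorm (qn ev l0) := by
  refine ⟨⟨qn_nonneg hg, qn_add hg, qn_smul hg, qn_mul hg, qn_star hg, qn_cstar hg⟩, fun x hx => ?_⟩
  exact nu_faithful x (le_antisymm (hx ▸ nu_le_qn hg x) (nu_nonneg x))

end Quot

set_option synthInstance.maxHeartbeats 1000000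
set_option maxHeartbeats 1000000
open scoped TensorProduct

section Words

/-- the unit ball of `B(ℓ²)`. -/
abbrev BB : Type := {x : BE // ‖x‖ ≤ 1}

/-- Letters: (starred) generators and scalars. -/
abbrev Ltr (X : Type) : Type := ((Fin 5 ⊕ X) × Bool) ⊕ ℕ

/-- Value of a generator. -/
def gval {X : Type} (w : Fin 5 → BE) (h : X → BE) : Fin 5 ⊕ X → BE := Sum.elim w h

/-- Value of a letter. -/
noncomputable def lval {X : Type} (w : Fin 5 → BE) (h : X → BE) : Ltr X → BE
  | Sum.inl (g, b) => if b then star (gval w h g) else gval w h g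
  | Sum.inr n => algebraMap ℂ BE (TopologicalSpace.denseSeq ℂ n)

/-- Value of a noncommutative polynomial. -/
noncomputable def we {X : Type} (w : Fin 5 → BE) (h : X → BE) : FreeAlgebra ℤ (Ltr X) →ₐ[ℤ] BE :=
  FreeAlgebra.lift ℤ (lval w h)

/-- Relabelling of letters. -/
def lmap {X Y : Type} (f : X → Y) : Ltr X → Ltr Y :=
  Sum.map (Prod.map (Sum.map id f) id) id

/-- Relabelling of polynomials. -/
noncomputable def wmap {X Y : Type} (f : X → Y) : FreeAlgebra ℤ (Ltr X) →ₐ[ℤ] FreeAlgebra ℤ (Ltr Y) :=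
  FreeAlgebra.lift ℤ (fun l => FreeAlgebra.ι ℤ (lmap f l))

lemma we_wmap {X Y : Type} (f : X → Y) (w : Fin 5 → BE) (h : Y → BE) (p : FreeAlgebra ℤ (Ltr X)) :
    we w h (wmap f p) = we w (h ∘ f) p := by
  have : (we w h).comp (wmap f) = we w (h ∘ f) := by
    refine FreeAlgebra.hom_ext (funext fun l => ?_)
    simp only [Function.comp_apply, AlgHom.comp_apply, wmap, we, FreeAlgebra.lift_ι_apply]
    rcases l with ⟨g | x, b⟩ | n <;> rfl
  exact DFunLike.congr_fun this p

lemma we_supp {X : Type} (p : FreeAlgebra ℤ (Ltr X)) : ∃ T : Finset X, ∀ φ ψ : X → BE,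
    (∀ x ∈ T, φ x = ψ x) → ∀ w, we w φ p = we w ψ p := by
  classical
  induction p using FreeAlgebra.induction with
  | grade0 r => exact ⟨∅, fun φ ψ _ w => by rw [AlgHom.commutes, AlgHom.commutes]⟩
  | grade1 l =>
    rcases l with ⟨g | x, b⟩ | n
    · exact ⟨∅, fun φ ψ _ w => by simp [we, lval, gval]⟩
    · exact ⟨{x}, fun φ ψ h w => by simp [we, lval, gval, h]⟩
    · exact ⟨∅, fun φ ψ _ w => by simp [we, lval]⟩
  | mul a b ha hb =>
    obtain ⟨S, hS⟩ := ha
    obtain ⟨T, hT⟩ := hb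
    refine ⟨S ∪ T, fun φ ψ h w => ?_⟩
    rw [map_mul, map_mul, hS φ ψ (fun x hx => h x (Finset.mem_union_left _ hx)),
      hT φ ψ (fun x hx => h x (Finset.mem_union_right _ hx))]
  | add a b ha hb =>
    obtain ⟨S, hS⟩ := ha
    obtain ⟨T, hT⟩ := hb
    refine ⟨S ∪ T, fun φ ψ h w => ?_⟩
    rw [map_add, map_add, hS φ ψ (fun x hx => h x (Finset.mem_union_left _ hx)),
      hT φ ψ (fun x hx => h x (Finset.mem_union_right _ hx))]

lemma countable_words : Countable (FreeAlgebra ℤ (Ltr ℕ)) := by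
  rw [← Cardinal.mk_le_aleph0_iff]
  refine (FreeAlgebra.cardinalMk_le_max ℤ (Ltr ℕ)).trans ?_
  simp

end Words

section Norms

variable (d : Dat) (s : Set Nat.Primes)

/-- The index set. -/
abbrev Lam : Type := {wh : (Fin 5 → BB) × (BB → BB) //
  nu (∑ g, (wh.1 g : BE) ⊗ₜ[ℂ] d.V s g) ≤ 5 - 1 / 200}

/-- The coordinates of an index. -/
def Lam.w {d : Dat} {s : Set Nat.Primes} (l : Lam d s) : Fin 5 → BE := fun g => (l.1.1 g : BE)
/-- The coordinates of an index. -/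
def Lam.h {d : Dat} {s : Set Nat.Primes} (l : Lam d s) : BB → BE := fun x => (l.1.2 x : BE)

/-- The unitaries in the ball. -/
noncomputable def ub (d : Dat) (s : Set Nat.Primes) (g : Fin 5) : BB := ⟨d.U s g, d.norm_U s g⟩

/-- An index with the first coordinate standard. -/
noncomputable def stdL (h : BB → BB) : Lam d s := ⟨(ub d s, h), d.upper s⟩

/-- Generators. -/
def gf (x : Fin 5 ⊕ BB) : Lam d s → BE := fun l => gval l.w l.h x

/-- The algebra of functions. -/
noncomputable def CC : StarSubalgebra ℂ (Lam d s → BE) :=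
  StarAlgebra.adjoin ℂ (Set.range (gf d s))

/-- Evaluations. -/
noncomputable def evl (l : Lam d s) : CC d s →⋆ₐ[ℂ] BE :=
  (Pi.evalStarAlgHom ℂ (fun _ : Lam d s => BE) l).comp (CC d s).subtype

lemma evl_apply (l : Lam d s) (c : CC d s) : evl d s l c = (c : Lam d s → BE) l := rfl

/-- generators as elements. -/
noncomputable def gen (x : Fin 5 ⊕ BB) : CC d s :=
  ⟨gf d s x, StarAlgebra.subset_adjoin ℂ _ ⟨x, rfl⟩⟩

lemma norm_gf (x : Fin 5 ⊕ BB) (l : Lam d s) : ‖gf d s x l‖ ≤ 1 := by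
  rcases x with g | x
  · exact (l.1.1 g).2
  · exact (l.1.2 x).2

lemma CC_approx (c : Lam d s → BE) (hc : c ∈ CC d s) : (∃ M : ℝ, ∀ l, ‖c l‖ ≤ M) ∧
    ∀ ε : ℝ, 0 < ε → ∃ p : FreeAlgebra ℤ (Ltr BB), ∀ l, ‖c l - we l.w l.h p‖ ≤ ε := by
  have hc' : c ∈ Algebra.adjoin ℂ (Set.range (gf d s) ∪ star (Set.range (gf d s))) := by
    rw [← StarAlgebra.adjoin_toSubalgebra]; exact hc
  clear hc
  induction hc' using Algebra.adjoin_induction with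
  | mem x hx =>
    rcases hx with ⟨g, rfl⟩ | hx
    · refine ⟨⟨1, norm_gf d s g⟩, fun ε hε => ⟨FreeAlgebra.ι ℤ (Sum.inl (g, false)), fun l => ?_⟩⟩
      simp only [we, FreeAlgebra.lift_ι_apply, lval, gf]
      simpa using hε.le
    · obtain ⟨g, hg⟩ := hx
      have hx : x = star (gf d s g) := by rw [hg, star_star]
      subst hx
      refine ⟨⟨1, fun l => ?_⟩, fun ε hε => ⟨FreeAlgebra.ι ℤ (Sum.inl (g, true)), fun l => ?_⟩⟩
      · rw [Pi.star_apply]; exact (norm_star (gf d s g l)).trans_le (norm_gf d s g l)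
      · rw [Pi.star_apply]
        simp only [we, FreeAlgebra.lift_ι_apply, lval, gf]
        simpa using hε.le
  | algebraMap r =>
    refine ⟨⟨‖algebraMap ℂ BE r‖, fun l => le_rfl⟩, fun ε hε => ?_⟩
    obtain ⟨n, hn⟩ := (TopologicalSpace.denseRange_denseSeq ℂ).exists_dist_lt r hε
    refine ⟨FreeAlgebra.ι ℤ (Sum.inr n), fun l => ?_⟩
    simp only [we, FreeAlgebra.lift_ι_apply, lval, Pi.algebraMap_apply]
    rw [← map_sub]
    refine (norm_algebraMap BE _).trans_le ?_
    rw [← dist_eq_norm]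
    have h1 : ‖(1 : BE)‖ ≤ 1 := ContinuousLinearMap.norm_id_le
    calc _ ≤ ε * 1 := by
          gcongr
      _ = ε := mul_one ε
  | add x y _ _ hx hy =>
    obtain ⟨⟨M, hM⟩, hx⟩ := hx
    obtain ⟨⟨N, hN⟩, hy⟩ := hy
    refine ⟨⟨M + N, fun l => (norm_add_le _ _).trans (add_le_add (hM l) (hN l))⟩, fun ε hε => ?_⟩
    obtain ⟨p, hp⟩ := hx (ε / 2) (by linarith)
    obtain ⟨q, hq⟩ := hy (ε / 2) (by linarith)
    refine ⟨p + q, fun l => ?_⟩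
    rw [Pi.add_apply, map_add, add_sub_add_comm]
    refine (norm_add_le _ _).trans ?_
    linarith [hp l, hq l]
  | mul x y _ _ hx hy =>
    obtain ⟨⟨M, hM⟩, hx⟩ := hx
    obtain ⟨⟨N, hN⟩, hy⟩ := hy
    have hM0 : 0 ≤ M := (norm_nonneg _).trans (hM (stdL d s id))
    have hN0 : 0 ≤ N := (norm_nonneg _).trans (hN (stdL d s id))
    refine ⟨⟨M * N, fun l => (norm_mul_le _ _).trans
      (mul_le_mul (hM l) (hN l) (norm_nonneg _) hM0)⟩, fun ε hε => ?_⟩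
    obtain ⟨q, hq⟩ := hy (min 1 (ε / (2 * (M + 1)))) (by positivity)
    obtain ⟨p, hp⟩ := hx (ε / (2 * (N + 1))) (by positivity)
    refine ⟨p * q, fun l => ?_⟩
    rw [Pi.mul_apply, map_mul]
    have e : x l * y l - we l.w l.h p * we l.w l.h q =
        x l * (y l - we l.w l.h q) + (x l - we l.w l.h p) * we l.w l.h q := by
      noncomm_ring
    have h1 : ‖we l.w l.h q‖ ≤ N + 1 := by
      have := norm_sub_norm_le (we l.w l.h q) (y l)
      rw [norm_sub_rev] at this
      linarith [hN l, (hq l).trans (min_le_left _ _)]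
    rw [e]
    calc _ ≤ ‖x l‖ * ‖y l - we l.w l.h q‖ + ‖x l - we l.w l.h p‖ * ‖we l.w l.h q‖ :=
          (norm_add_le _ _).trans (add_le_add (norm_mul_le _ _) (norm_mul_le _ _))
      _ ≤ (M + 1) * (ε / (2 * (M + 1))) + (ε / (2 * (N + 1))) * (N + 1) := by
          gcongr
          · linarith [hM l]
          · exact (hq l).trans (min_le_right _ _)
          · exact hp l
      _ = ε := by field_simp; ring

lemma evl_surj : Function.Surjective (evl d s (stdL d s id)) := by
  intro x
  by_cases hx : x = 0
  · exact ⟨0, by rw [map_zero, hx]⟩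
  have hx' : ‖x‖ ≠ 0 := norm_ne_zero_iff.2 hx
  have hn : ‖((‖x‖ : ℂ)⁻¹) • x‖ ≤ 1 := by
    rw [norm_smul, norm_inv, Complex.norm_real, norm_norm, inv_mul_cancel₀ hx']
  refine ⟨(‖x‖ : ℂ) • gen d s (Sum.inr ⟨_, hn⟩), ?_⟩
  rw [map_smul]
  change (‖x‖ : ℂ) • ((‖x‖ : ℂ)⁻¹ • x) = x
  rw [smul_smul, mul_inv_cancel₀ (by exact_mod_cast hx'), one_smul]

lemma evl_good : GoodEv (evl d s) (stdL d s id) :=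
  ⟨fun c => (CC_approx d s c c.2).1, evl_surj d s⟩

/-- The norm attached to `s`. -/
noncomputable def bn : BE ⊗[ℂ] BE → ℝ := qn (evl d s) (stdL d s id)

lemma bn_isCstarNorm : IsCstarNorm (bn d s) := qn_isCstarNorm (evl_good d s)

/-- The test element. -/
noncomputable def tt (k : Set Nat.Primes) : BE ⊗[ℂ] BE := ∑ g, d.U k g ⊗ₜ[ℂ] d.V k g

lemma bn_tt : bn d s (tt d s) ≤ 5 - 1 / 200 := by
  refine qn_le ⟨∑ g, gen d s (Sum.inl g) ⊗ₜ[ℂ] d.V s g, ?_, fun l => ?_⟩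
  · rw [map_sum]; rfl
  · rw [map_sum]; exact l.2

end Norms

set_option synthInstance.maxHeartbeats 1000000
set_option maxHeartbeats 1000000
open scoped TensorProduct

section Count

variable (d : Dat) (s : Set Nat.Primes)

lemma nu_sum_mul_sub (a : Fin 5 → BE) (ha : ∀ g, ‖a g‖ ≤ 1) (k : Set Nat.Primes) (u v : BE) (δ : ℝ)
    (h : ‖u - v‖ ≤ δ) :
    nu (∑ g, (a g * u) ⊗ₜ[ℂ] d.V k g) ≤ nu (∑ g, (a g * v) ⊗ₜ[ℂ] d.V k g) + 5 * δ := by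
  have hδ : 0 ≤ δ := (norm_nonneg _).trans h
  have e : (∑ g, (a g * u) ⊗ₜ[ℂ] d.V k g) = (∑ g, (a g * v) ⊗ₜ[ℂ] d.V k g) +
      ∑ g, (a g * (u - v)) ⊗ₜ[ℂ] d.V k g := by
    rw [← Finset.sum_add_distrib]
    refine Finset.sum_congr rfl fun g _ => ?_
    rw [← TensorProduct.add_tmul, ← mul_add, add_sub_cancel]
  rw [e]
  refine (nu_add _ _).trans (add_le_add le_rfl ((nu_sum _ _).trans ?_))
  calc _ ≤ ∑ g : Fin 5, δ := by
        refine Finset.sum_le_sum fun g _ => (nu_tmul _ _).trans ?_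
        calc ‖a g * (u - v)‖ * ‖d.V k g‖ ≤ (1 * δ) * 1 := by
              refine mul_le_mul ((norm_mul_le _ _).trans ?_) (d.norm_V k g) (norm_nonneg _)
                (by linarith)
              exact mul_le_mul (ha g) h (norm_nonneg _) zero_le_one
          _ = δ := by ring
    _ = 5 * δ := by simp

lemma exists_word (k : Set Nat.Primes) (hk : bn d s (tt d k) ≤ 5 - 1 / 200) :
    ∃ p : FreeAlgebra ℤ (Ltr BB),
      (∀ l : Lam d s, nu (∑ g, (l.h (ub d k g) * we l.w l.h p) ⊗ₜ[ℂ] d.V k g) ≤ 5 - 1 / 400) ∧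
      ‖(1 : BE) - we (stdL d s id).w (stdL d s id).h p‖ ≤ 1 / 10000 := by
  obtain ⟨y, hy, hy'⟩ := mem_of_qn_lt (evl_good d s) (x := tt d k) (r := 5 - 1 / 300)
    (lt_of_le_of_lt hk (by norm_num))
  set x0 : CC d s ⊗[ℂ] BE := ∑ g, gen d s (Sum.inr (ub d k g)) ⊗ₜ[ℂ] d.V k g with hx0
  have hx0' : evT (evl d s (stdL d s id)) x0 = tt d k := by
    rw [hx0, map_sum]; rfl
  obtain ⟨c, -, hc0, hc1, hc2⟩ := ker_cut (evl_good d s) (x0 - y)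
    (by rw [map_sub, hx0', hy, sub_self]) (1 / 4000) (by norm_num)
  obtain ⟨p, hp⟩ := (CC_approx d s c c.2).2 (1 / 10000) (by norm_num)
  refine ⟨p, fun l => ?_, ?_⟩
  · have h1 := nu_sum_mul_sub d (fun g => l.h (ub d k g)) (fun g => (l.1.2 (ub d k g)).2) k
      (we l.w l.h p) (evl d s l c) (1 / 10000) (by rw [norm_sub_rev]; exact hp l)
    have e : evT (evl d s l) ((x0 - y) * (c ⊗ₜ[ℂ] (1 : BE))) =
        (∑ g, (l.h (ub d k g) * evl d s l c) ⊗ₜ[ℂ] d.V k g) -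
          evT (evl d s l) y * evT (evl d s l) (c ⊗ₜ[ℂ] (1 : BE)) := by
      rw [map_mul, map_sub, hx0, map_sum]
      refine (sub_mul (∑ g, evT (evl d s l) (gen d s (Sum.inr (ub d k g)) ⊗ₜ[ℂ] d.V k g))
        (evT (evl d s l) y) (evT (evl d s l) (c ⊗ₜ[ℂ] (1 : BE)))).trans ?_
      congr 1
      refine (Finset.sum_mul Finset.univ
        (fun g => evT (evl d s l) (gen d s (Sum.inr (ub d k g)) ⊗ₜ[ℂ] d.V k g)) _).trans ?_
      refine Finset.sum_congr rfl fun g _ => ?_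
      rw [evT_tmul, evT_tmul, Algebra.TensorProduct.tmul_mul_tmul, mul_one]
      rfl
    have h2 : nu (evT (evl d s l) (c ⊗ₜ[ℂ] (1 : BE))) ≤ 1 := by
      rw [evT_tmul]
      refine (nu_tmul _ _).trans ?_
      calc ‖evl d s l c‖ * ‖(1 : BE)‖ ≤ 1 * 1 := by
            gcongr
            · exact hc1 l
            · exact ContinuousLinearMap.norm_id_le
        _ = 1 := one_mul 1
    have h3 : nu (evT (evl d s l) y * evT (evl d s l) (c ⊗ₜ[ℂ] (1 : BE))) ≤ (5 - 1 / 300) * 1 :=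
      (nu_mul _ _).trans (mul_le_mul (hy' l) h2 (nu_nonneg _) (by norm_num))
    have h4 := hc2 l
    have h5 := nu_add (evT (evl d s l) ((x0 - y) * (c ⊗ₜ[ℂ] (1 : BE))))
      (evT (evl d s l) y * evT (evl d s l) (c ⊗ₜ[ℂ] (1 : BE)))
    rw [e] at h5 h4
    rw [sub_add_cancel] at h5
    linarith
  · rw [← hc0]; exact hp _

lemma bad_countable : {k : Set Nat.Primes | bn d s (tt d k) ≤ 5 - 1 / 200}.Countable := by
  classical
  have hex : ∀ k : {k : Set Nat.Primes | bn d s (tt d k) ≤ 5 - 1 / 200},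
      ∃ (p : FreeAlgebra ℤ (Ltr BB)) (code : BB → ℕ) (dec : ℕ → BB),
      (∀ l : Lam d s, nu (∑ g, (l.h (ub d k g) * we l.w l.h p) ⊗ₜ[ℂ] d.V k g) ≤ 5 - 1 / 400) ∧
      ‖(1 : BE) - we (stdL d s id).w (stdL d s id).h p‖ ≤ 1 / 10000 ∧
      (∀ g, dec (code (ub d k g)) = ub d k g) ∧
      we (stdL d s id).w (fun x => (dec (code x) : BE)) p =
        we (stdL d s id).w (stdL d s id).h p := by
    rintro ⟨k, hk⟩
    obtain ⟨p, hp1, hp2⟩ := exists_word d s k hk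
    obtain ⟨T, hT⟩ := we_supp p
    set T' : Finset BB := T ∪ Finset.univ.image (ub d k) with hT'
    obtain ⟨code, hcode⟩ : ∃ code : BB → ℕ, Set.InjOn code T' :=
      Set.countable_iff_exists_injOn.1 T'.finite_toSet.countable
    have : Nonempty BB := ⟨ub d k 0⟩
    have hdec : ∀ x ∈ T', Function.invFunOn code T' (code x) = x := fun x hx =>
      hcode.leftInvOn_invFunOn hx
    refine ⟨p, code, Function.invFunOn code T', hp1, hp2, fun g => ?_, ?_⟩
    · exact hdec _ (Finset.mem_union_right _ (Finset.mem_image_of_mem _ (Finset.mem_univ g)))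
    · refine hT _ _ (fun x hx => ?_) _
      rw [hdec x (Finset.mem_union_left _ hx)]
      rfl
  choose p code dec h1 h2 h3 h4 using hex
  haveI := countable_words
  refine Set.countable_coe_iff.1 (Function.Injective.countable
    (f := fun k => (wmap (code k) (p k), fun g => code k (ub d k g))) ?_)
  have key : ∀ k k' : {k : Set Nat.Primes | bn d s (tt d k) ≤ 5 - 1 / 200},
      (wmap (code k) (p k), fun g => code k (ub d k g)) =
      (wmap (code k') (p k'), fun g => code k' (ub d k' g)) →
      (k : Set Nat.Primes) ⊆ k' := by
    intro k k' hkk q hq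
    by_contra hq'
    obtain ⟨e1, e2⟩ := Prod.mk.inj hkk
    have hlow := d.lower k k' q hq hq'
    set l : Lam d s := stdL d s (fun x => dec k (code k' x)) with hl
    have hw : we l.w l.h (p k') = we (stdL d s id).w (stdL d s id).h (p k) := by
      rw [← h4 k]
      have a1 := we_wmap (code k) (stdL d s id).w (fun n => (dec k n : BE)) (p k)
      have a2 := we_wmap (code k') (stdL d s id).w (fun n => (dec k n : BE)) (p k')
      rw [e1] at a1
      exact a2.symm.trans a1
    have hU : ∀ g, l.h (ub d k' g) = d.U k g := by
      intro g
      change ((dec k (code k' (ub d k' g)) : BB) : BE) = _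
      rw [← congrFun e2 g, h3]
      rfl
    have b1 := h1 k' l
    simp only [hw, hU] at b1
    have b2 := nu_sum_mul_sub d (fun g => d.U k g) (d.norm_U k) k' 1 _ _ (h2 k)
    simp only [mul_one] at b2
    linarith
  intro k k' hkk
  exact Subtype.ext (Set.Subset.antisymm (key k k' hkk) (key k' k hkk.symm))

/-- The set of C*-norms on the algebraic tensor product
`B(ℓ²) ⊗[ℂ] B(ℓ²)` has cardinality at least `2 ^ ℵ₀`, the cardinality of the continuum. -/
theorem continuum_le_card_aux (d : Dat) :
    Cardinal.continuum ≤
      Cardinal.mk {f : ((ellTwo →L[ℂ] ellTwo) ⊗[ℂ] (ellTwo →L[ℂ] ellTwo)) → ℝ //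
        IsCstarNorm f} := by
  have hcard : Cardinal.mk (Set Nat.Primes) = Cardinal.continuum := by
    rw [Cardinal.mk_set, Cardinal.mk_eq_aleph0, Cardinal.two_power_aleph0]
  let F : Set Nat.Primes → {f : BE ⊗[ℂ] BE → ℝ // IsCstarNorm f} :=
    fun s => ⟨bn d s, bn_isCstarNorm d s⟩
  change _ ≤ Cardinal.mk {f : BE ⊗[ℂ] BE → ℝ // IsCstarNorm f}
  have hfib : ∀ f, Cardinal.mk (F ⁻¹' {f}) ≤ Cardinal.aleph0 := by
    intro f
    rw [Cardinal.le_aleph0_iff_set_countable]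
    rcases (F ⁻¹' {f}).eq_empty_or_nonempty with h | ⟨s, hs⟩
    · rw [h]; exact Set.countable_empty
    · refine (bad_countable d s).mono fun k hk => ?_
      have e : F s = F k := hs.trans hk.symm
      have e' : bn d s = bn d k := congrArg Subtype.val e
      rw [Set.mem_setOf_eq, e']
      exact bn_tt d k
  by_contra hlt
  rw [not_le] at hlt
  have h1 : Cardinal.mk (Set Nat.Primes) ≤
      Cardinal.mk {f : BE ⊗[ℂ] BE → ℝ // IsCstarNorm f} * Cardinal.aleph0 := by
    rw [← Cardinal.mk_congr (Equiv.sigmaFiberEquiv F), Cardinal.mk_sigma]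
    refine (Cardinal.sum_le_sum _ (fun _ => Cardinal.aleph0) hfib).trans ?_
    rw [Cardinal.sum_const']
  rw [hcard] at h1
  exact absurd h1 (not_le.2 (Cardinal.mul_lt_of_lt Cardinal.aleph0_le_continuum hlt
    Cardinal.aleph0_lt_continuum))

end Count

/-- The set of C*-norms on the algebraic tensor product
`B(ℓ²) ⊗[ℂ] B(ℓ²)` has cardinality at least `2 ^ ℵ₀`, the cardinality of the continuum. -/
theorem continuum_le_card_cstarNorms_BH_tensor_BH :
    Cardinal.continuum ≤
      Cardinal.mk {f : ((ellTwo →L[ℂ] ellTwo) ⊗[ℂ] (ellTwo →L[ℂ] ellTwo)) → ℝ //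
        IsCstarNorm f} := by
  obtain ⟨d⟩ := exists_dat
  exact continuum_le_card_aux d
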